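/- arXiv:2001.02484 — 4 statements merged into one kernel-verified Lean document; each statement's English description precedes it below -/
import Mathlib

section
/- For every integer t ≥ 1, the infimum of the circular flow numbers of bridgeless (2t+1)-regular class 2 multigraphs equals 2 + 2/(2t−1); that is, Φ^(2)(2t+1) = 2 + 2/(2t−1). -/
/-!
Basic theory of finite multigraphs (parallel edges allowed, no loops),
nowhere-zero `r`-flows, the circular flow number, proper edge colorings,
the chromatic index, class 1 / class 2, perfect matchings, edge cuts,
`r`-bipartitions, and the operation of adding parallel copies of a matching.
-/

/-- A finite multigraph: a finite type of vertices, a finite type of edges,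
each edge having an (ordered, for reference purposes) pair of distinct endpoints.
Parallel edges are allowed; loops are excluded. -/
structure Multigraph : Type 1 where
  V : Type
  E : Type
  vFinite : Finite V
  eFinite : Finite E
  ends : E → V × V
  no_loop : ∀ e, (ends e).1 ≠ (ends e).2

namespace Multigraph

variable (G : Multigraph)

instance : Finite G.V := G.vFinite
instance : Finite G.E := G.eFinite

/-- The first endpoint of an edge (w.r.t. the reference orientation). -/
def tail (e : G.E) : G.V := (G.ends e).1

/-- The second endpoint of an edge (w.r.t. the reference orientation). -/
def head (e : G.E) : G.V := (G.ends e).2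

/-- `v` is an endpoint of the edge `e`. -/
def Inc (v : G.V) (e : G.E) : Prop := G.tail e = v ∨ G.head e = v

open Classical in
/-- The endpoint of `e` other than `v`. -/
noncomputable def otherEnd (e : G.E) (v : G.V) : G.V :=
  if G.tail e = v then G.head e else G.tail e

/-- The degree of a vertex: the number of edges incident with it
(no loops, so no edge is counted twice). -/
noncomputable def degree (v : G.V) : ℕ := Nat.card {e : G.E // G.Inc v e}

/-- `G` is `k`-regular. -/
def IsRegular (k : ℕ) : Prop := ∀ v, G.degree v = k

/-- The maximum degree `Δ(G)`. -/
noncomputable def maxDegree : ℕ := sSup (Set.range G.degree)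

/-- Two distinct edges are adjacent if they share an endpoint. -/
def EAdj (e e' : G.E) : Prop := e ≠ e' ∧ ∃ v, G.Inc v e ∧ G.Inc v e'

/-- A proper edge coloring with `k` colors: adjacent edges get distinct colors. -/
def IsProperEdgeColoring {k : ℕ} (c : G.E → Fin k) : Prop :=
  ∀ e e', G.EAdj e e' → c e ≠ c e'

/-- The chromatic index `χ'(G)`. -/
noncomputable def chromaticIndex : ℕ :=
  sInf {k | ∃ c : G.E → Fin k, G.IsProperEdgeColoring c}

/-- `G` is class 1 if `χ'(G) = Δ(G)`. -/
def IsClass1 : Prop := G.chromaticIndex = G.maxDegree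

/-- `G` is class 2 if it is not class 1. -/
def IsClass2 : Prop := ¬ G.IsClass1

/-- A nowhere-zero `r`-flow: the orientation `D` is encoded by the signs of `f`
(a negative value means the edge is used against its reference direction), every
edge has absolute flow value in `[1, r-1]`, and Kirchhoff's law holds at every
vertex. -/
def IsNZFlow (r : ℝ) (f : G.E → ℝ) : Prop :=
  (∀ e, 1 ≤ |f e| ∧ |f e| ≤ r - 1) ∧
  ∀ v : G.V, ∑ᶠ e ∈ {e | G.tail e = v}, f e = ∑ᶠ e ∈ {e | G.head e = v}, f e

/-- `G` admits a nowhere-zero `r`-flow. -/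
def HasNZFlow (r : ℝ) : Prop := ∃ f, G.IsNZFlow r f

/-- The circular flow number `φ_c(G)`, as an extended real number:
the infimum of all real `r ≥ 2` such that `G` has a nowhere-zero `r`-flow
(`+∞` if there is no such `r`, e.g. if `G` has a bridge). -/
noncomputable def flowNumber : EReal :=
  sInf {x : EReal | ∃ r : ℝ, x = (r : EReal) ∧ 2 ≤ r ∧ G.HasNZFlow r}

/-- A perfect matching: every vertex is incident with exactly one edge of `M`. -/
def IsPerfectMatching (M : Set G.E) : Prop :=
  ∀ v, ∃! e, e ∈ M ∧ G.Inc v e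

/-- `G` is bipartite: the vertices can be 2-colored with every edge bichromatic. -/
def IsBipartite : Prop :=
  ∃ s : Set G.V, ∀ e, ¬ (G.tail e ∈ s ↔ G.head e ∈ s)

/-- The edge cut `∂_G(X)`: edges with exactly one end in `X`. -/
def cut (X : Set G.V) : Set G.E := {e | ¬ (G.tail e ∈ X ↔ G.head e ∈ X)}

/-- Add, for each `i : Fin k`, one new parallel copy of each edge of `M i`. -/
noncomputable def addEdgeFamily {k : ℕ} (M : Fin k → Set G.E) : Multigraph where
  V := G.V
  E := G.E ⊕ ((i : Fin k) × ↥(M i))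
  vFinite := by infer_instance
  eFinite := by infer_instance
  ends := Sum.elim G.ends (fun p => G.ends p.2.1)
  no_loop := by
    rintro (e | ⟨i, e⟩)
    · exact G.no_loop e
    · exact G.no_loop e.1

/-- `G + kM`: add `k` new parallel copies of each edge of `M`. -/
noncomputable def addCopies (M : Set G.E) (k : ℕ) : Multigraph :=
  G.addEdgeFamily (fun _ : Fin k => M)

/-- Delete a set of edges. -/
noncomputable def deleteEdges (M : Set G.E) : Multigraph where
  V := G.V
  E := {e : G.E // e ∉ M}
  vFinite := G.vFinite
  eFinite := by infer_instance
  ends := fun e => G.ends e.1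
  no_loop := fun e => G.no_loop e.1

/-- Vertex adjacency (there is an edge between `u` and `v`). -/
def VAdj (u v : G.V) : Prop := ∃ e, G.ends e = (u, v) ∨ G.ends e = (v, u)

/-- Reachability by walks. -/
def Reach : G.V → G.V → Prop := Relation.ReflTransGen G.VAdj

/-- `G` is connected. -/
def Connected : Prop := ∀ u v, G.Reach u v

/-- An edge is a bridge if its ends are not joined by a walk avoiding it. -/
def IsBridge (e : G.E) : Prop :=
  ¬ (G.deleteEdges {e}).Reach (G.tail e) (G.head e)

/-- `G` is bridgeless. -/
def Bridgeless : Prop := ∀ e, ¬ G.IsBridge e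

/-- An `r`-bipartition of (the vertex set of) a cubic graph. -/
def IsRBipartition (r : ℝ) (B W : Set G.V) : Prop :=
  B ∪ W = Set.univ ∧ B ∩ W = ∅ ∧
  ∀ X : Set G.V,
    (r / (r - 2)) * |((X ∩ B).ncard : ℝ) - ((X ∩ W).ncard : ℝ)| ≤ ((G.cut X).ncard : ℝ)

/-- A cubic graph `G` with a perfect matching `M` has the `M`-class-2 property
if `G + (2t-2)M` is class 2 for every integer `t ≥ 1`. -/
def MClass2Property (M : Set G.E) : Prop :=
  ∀ t : ℕ, 1 ≤ t → (G.addCopies M (2 * t - 2)).IsClass2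

/-- A cubic graph `G` with a perfect matching `M` has the `M`-class-1 property
if `G + (2t-2)M` is class 1 for every integer `t ≥ 2`. -/
def MClass1Property (M : Set G.E) : Prop :=
  ∀ t : ℕ, 2 ≤ t → (G.addCopies M (2 * t - 2)).IsClass1

/-- An `r`-graph: an `r`-regular multigraph in which every odd set of vertices
is left by at least `r` edges. -/
def IsRGraph (r : ℕ) : Prop :=
  G.IsRegular r ∧ ∀ X : Set G.V, Odd X.ncard → r ≤ (G.cut X).ncard

end Multigraph

namespace Multigraph

open Finset

/-- König's edge-colouring theorem for regular bipartite incidence structures. -/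
theorem konig_aux (k : ℕ) : ∀ {E A B : Type} [Finite E] [Finite A] [Finite B]
    (a : E → A) (b : E → B)
    (_ : ∀ x, Nat.card {e // a e = x} = k) (_ : ∀ y, Nat.card {e // b e = y} = k),
    ∃ c : E → Fin k, (∀ e e', e ≠ e' → a e = a e' → c e ≠ c e') ∧
      (∀ e e', e ≠ e' → b e = b e' → c e ≠ c e') := by
  classical
  induction k with
  | zero =>
    intro E A B _ _ _ a b ha hb
    have hE : IsEmpty E := by
      constructor
      intro e
      have h := ha (a e)
      rw [Finite.card_eq_zero_iff] at h
      exact h.false ⟨e, rfl⟩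
    exact ⟨fun e => hE.elim e, fun e => hE.elim e, fun e => hE.elim e⟩
  | succ k ih =>
    intro E A B _ _ _ a b ha hb
    have := Fintype.ofFinite E
    have := Fintype.ofFinite A
    have := Fintype.ofFinite B
    have ha' : ∀ x, #{e | a e = x} = k + 1 := by
      intro x; rw [← ha x, Nat.card_eq_fintype_card, Fintype.card_subtype]
    have hb' : ∀ x, #{e | b e = x} = k + 1 := by
      intro x; rw [← hb x, Nat.card_eq_fintype_card, Fintype.card_subtype]
    let T : A → Finset B := fun x => ({e | a e = x} : Finset E).image b
    have hall : ∀ S : Finset A, #S ≤ #(S.biUnion T) := by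
      intro S
      have h1 : #({e | a e ∈ S} : Finset E) = (k + 1) * #S := by
        rw [Finset.card_eq_sum_card_fiberwise (f := a) (t := S) (by intro e he; simpa using he)]
        rw [Finset.sum_congr rfl (g := fun _ => k + 1)]
        · simp [mul_comm]
        · intro x hx
          rw [← ha' x]
          congr 1
          ext e
          simp only [mem_filter, mem_univ, true_and]
          constructor
          · exact fun h => h.2
          · exact fun h => ⟨h ▸ hx, h⟩
      have h2 : #({e | b e ∈ S.biUnion T} : Finset E) = (k + 1) * #(S.biUnion T) := by
        rw [Finset.card_eq_sum_card_fiberwise (f := b) (t := S.biUnion T)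
          (by intro e he; simpa using he)]
        rw [Finset.sum_congr rfl (g := fun _ => k + 1)]
        · simp [mul_comm]
        · intro x hx
          rw [← hb' x]
          congr 1
          ext e
          simp only [mem_filter, mem_univ, true_and]
          constructor
          · exact fun h => h.2
          · exact fun h => ⟨h ▸ hx, h⟩
      have h3 : #({e | a e ∈ S} : Finset E) ≤ #({e | b e ∈ S.biUnion T} : Finset E) := by
        apply Finset.card_le_card
        intro e he
        simp only [mem_filter, mem_univ, true_and] at he
        simp only [mem_filter, mem_univ, true_and, mem_biUnion]
        exact ⟨a e, he, Finset.mem_image.2 ⟨e, by simp, rfl⟩⟩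
      rw [h1, h2] at h3
      exact Nat.le_of_mul_le_mul_left h3 (Nat.succ_pos k)
    obtain ⟨φ, hφ, hφT⟩ := (Finset.all_card_le_biUnion_card_iff_exists_injective T).1 hall
    have hm : ∀ x, ∃ e, a e = x ∧ b e = φ x := by
      intro x
      have := hφT x
      simpa [T] using this
    choose m hma hmb using hm
    have hcard : Fintype.card A = Fintype.card B := by
      have h1 : Fintype.card E = (k + 1) * Fintype.card A := by
        rw [← Finset.card_univ,
          Finset.card_eq_sum_card_fiberwise (f := a) (t := univ) (by intro e he; simp)]
        simp [ha', mul_comm]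
      have h2 : Fintype.card E = (k + 1) * Fintype.card B := by
        rw [← Finset.card_univ,
          Finset.card_eq_sum_card_fiberwise (f := b) (t := univ) (by intro e he; simp)]
        simp [hb', mul_comm]
      exact Nat.eq_of_mul_eq_mul_left (Nat.succ_pos k) (h1.symm.trans h2)
    have hφb : Function.Bijective φ :=
      (Fintype.bijective_iff_injective_and_card φ).2 ⟨hφ, hcard⟩
    let M : Set E := Set.range m
    have key : ∀ {C : Type} (g : E → C) (y : C) (e₀ : E), e₀ ∈ M → g e₀ = y →
        (∀ e ∈ M, g e = y → e = e₀) → #{e | g e = y} = k + 1 →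
        Nat.card {e : {e // e ∉ M} // g e.1 = y} = k := by
      intro C g y e₀ h0 h0y hu hc
      have e1 : Nat.card {e : {e // e ∉ M} // g e.1 = y} =
          #(({e | g e = y} : Finset E).erase e₀) := by
        rw [← Nat.card_eq_finsetCard]
        refine Nat.card_congr ⟨fun e => ⟨e.1.1, ?_⟩, fun e => ⟨⟨e.1, ?_⟩, ?_⟩, ?_, ?_⟩
        · have h1 := e.1.2
          have h2 := e.2
          simp only [Finset.mem_erase, mem_filter, mem_univ, true_and]
          exact ⟨fun h => h1 (h ▸ h0), h2⟩
        · have h1 := e.2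
          simp only [Finset.mem_erase, mem_filter, mem_univ, true_and] at h1
          exact fun h => h1.1 (hu _ h h1.2)
        · have h1 := e.2
          simp only [Finset.mem_erase, mem_filter, mem_univ, true_and] at h1
          exact h1.2
        · intro e; rfl
        · intro e; rfl
      rw [e1, Finset.card_erase_of_mem (by simp [h0y]), hc]; rfl
    obtain ⟨c, hc1, hc2⟩ := ih (E := {e // e ∉ M}) (fun e => a e.1) (fun e => b e.1)
      (by
        intro x
        refine key a x (m x) ⟨x, rfl⟩ (hma x) ?_ (ha' x)
        rintro _ ⟨x', rfl⟩ h
        rw [hma] at h; rw [h])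
      (by
        intro y
        obtain ⟨x, rfl⟩ := hφb.2 y
        refine key b (φ x) (m x) ⟨x, rfl⟩ (hmb x) ?_ (hb' _)
        rintro _ ⟨x', rfl⟩ h
        rw [hmb] at h; rw [hφ h])
    refine ⟨fun e => if h : e ∈ M then Fin.last k else (c ⟨e, h⟩).castSucc, ?_, ?_⟩
    · intro e e' hne hae
      by_cases h : e ∈ M <;> by_cases h' : e' ∈ M
      · exfalso
        obtain ⟨x, rfl⟩ := h
        obtain ⟨x', rfl⟩ := h'
        rw [hma, hma] at hae
        exact hne (by rw [hae])
      · simp only [h, h', dite_true, dite_false]; exact (Fin.castSucc_lt_last _).ne'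
      · simp only [h, h', dite_true, dite_false]; exact (Fin.castSucc_lt_last _).ne
      · simp only [h, h', dite_false]
        intro hh
        exact hc1 ⟨e, h⟩ ⟨e', h'⟩ (by simpa using hne) hae (Fin.castSucc_injective _ hh)
    · intro e e' hne hae
      by_cases h : e ∈ M <;> by_cases h' : e' ∈ M
      · exfalso
        obtain ⟨x, rfl⟩ := h
        obtain ⟨x', rfl⟩ := h'
        rw [hmb, hmb] at hae
        exact hne (by rw [hφ hae])
      · simp only [h, h', dite_true, dite_false]; exact (Fin.castSucc_lt_last _).ne'
      · simp only [h, h', dite_true, dite_false]; exact (Fin.castSucc_lt_last _).ne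
      · simp only [h, h', dite_false]
        intro hh
        exact hc2 ⟨e, h⟩ ⟨e', h'⟩ (by simpa using hne) hae (Fin.castSucc_injective _ hh)

end Multigraph

namespace Multigraph

open Finset

theorem maxDegree_eq (G : Multigraph) {k : ℕ} (h : G.IsRegular k) [Nonempty G.V] :
    G.maxDegree = k := by
  have : Set.range G.degree = {k} := by
    ext x
    constructor
    · rintro ⟨v, rfl⟩; exact h v
    · rintro rfl; exact ⟨Classical.arbitrary _, h _⟩
  rw [maxDegree, this, csSup_singleton]

theorem coloring_inj (G : Multigraph) {k : ℕ} {c : G.E → Fin k} (hc : G.IsProperEdgeColoring c)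
    (v : G.V) : Function.Injective (fun e : {e : G.E // G.Inc v e} => c e.1) := by
  intro e e' h
  by_contra hne
  exact hc e.1 e'.1 ⟨fun h => hne (Subtype.ext h), v, e.2, e'.2⟩ h

theorem class1_of_bipartite (G : Multigraph) {k : ℕ} (hr : G.IsRegular k)
    (hb : G.IsBipartite) : G.IsClass1 := by
  classical
  rcases isEmpty_or_nonempty G.V with hV | hV
  · have hE : IsEmpty G.E := ⟨fun e => hV.elim (G.tail e)⟩
    have h1 : G.maxDegree = 0 := by
      rw [maxDegree, Set.range_eq_empty]; simp
    have h2 : G.chromaticIndex = 0 := by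
      apply Nat.sInf_eq_zero.2
      left
      exact ⟨fun e => hE.elim e, fun e => hE.elim e⟩
    rw [IsClass1, h1, h2]
  · rw [IsClass1, G.maxDegree_eq hr]
    obtain ⟨s, hs⟩ := hb
    let a : G.E → {v // v ∈ s} := fun e =>
      if h : G.tail e ∈ s then ⟨G.tail e, h⟩ else
        ⟨G.head e, by have := hs e; tauto⟩
    let b : G.E → {v // v ∉ s} := fun e =>
      if h : G.tail e ∈ s then ⟨G.head e, by have := hs e; tauto⟩ else
        ⟨G.tail e, h⟩
    have ha : ∀ e x, a e = x ↔ G.Inc x.1 e := by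
      intro e x
      by_cases h : G.tail e ∈ s
      · have h2 : G.head e ∉ s := by have := hs e; tauto
        simp only [a, h, dite_true, Inc, Subtype.ext_iff]
        constructor
        · exact Or.inl
        · rintro (h3 | h3)
          · exact h3
          · exact absurd (h3 ▸ x.2) h2
      · simp only [a, h, dite_false, Inc, Subtype.ext_iff]
        constructor
        · exact Or.inr
        · rintro (h3 | h3)
          · exact absurd (h3 ▸ x.2) h
          · exact h3
    have hb : ∀ e x, b e = x ↔ G.Inc x.1 e := by
      intro e x
      by_cases h : G.tail e ∈ s
      · simp only [b, h, dite_true, Inc, Subtype.ext_iff]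
        constructor
        · exact Or.inr
        · rintro (h3 | h3)
          · exact absurd (h3 ▸ h) x.2
          · exact h3
      · have h2 : G.head e ∈ s := by have := hs e; tauto
        simp only [b, h, dite_false, Inc, Subtype.ext_iff]
        constructor
        · exact Or.inl
        · rintro (h3 | h3)
          · exact h3
          · exact absurd (h3 ▸ h2) x.2
    obtain ⟨c, hc1, hc2⟩ := konig_aux k a b
      (by intro x; simp only [ha]; exact hr x.1) (by intro x; simp only [hb]; exact hr x.1)
    apply le_antisymm
    · apply Nat.sInf_le
      refine ⟨c, ?_⟩
      rintro e e' ⟨hne, v, hv, hv'⟩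
      by_cases h : v ∈ s
      · exact hc1 e e' hne (((ha e ⟨v, h⟩).2 hv).trans ((ha e' ⟨v, h⟩).2 hv').symm)
      · exact hc2 e e' hne (((hb e ⟨v, h⟩).2 hv).trans ((hb e' ⟨v, h⟩).2 hv').symm)
    · apply le_csInf
      · refine ⟨k, c, ?_⟩
        rintro e e' ⟨hne, v, hv, hv'⟩
        by_cases h : v ∈ s
        · exact hc1 e e' hne (((ha e ⟨v, h⟩).2 hv).trans ((ha e' ⟨v, h⟩).2 hv').symm)
        · exact hc2 e e' hne (((hb e ⟨v, h⟩).2 hv).trans ((hb e' ⟨v, h⟩).2 hv').symm)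
      · rintro j ⟨c', hc'⟩
        have v : G.V := Classical.arbitrary _
        have := Nat.card_le_card_of_injective _ (G.coloring_inj hc' v)
        rw [Nat.card_fin] at this
        exact (hr v).symm.le.trans this

theorem flow_sum (G : Multigraph) [Fintype G.E] [DecidableEq G.V] (f : G.E → ℝ) (p : G.E → G.V)
    (v : G.V) : ∑ᶠ e ∈ {e | p e = v}, f e = ∑ e, if p e = v then f e else 0 := by
  rw [← Finset.sum_filter]
  rw [← finsum_mem_coe_finset]
  simp

theorem bridgeless_of_flow (G : Multigraph) {r : ℝ} (h : G.HasNZFlow r) : G.Bridgeless := by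
  classical
  have := Fintype.ofFinite G.E
  have := Fintype.ofFinite G.V
  obtain ⟨f, hf, hk⟩ := h
  intro e hbr
  simp only [flow_sum] at hk
  let X : Finset G.V := {v | (G.deleteEdges {e}).Reach (G.tail e) v}
  have h1 : ∑ v ∈ X, ((∑ e', if G.tail e' = v then f e' else 0) -
      ∑ e', if G.head e' = v then f e' else 0) = 0 :=
    Finset.sum_eq_zero (fun v _ => by rw [hk v, sub_self])
  rw [Finset.sum_sub_distrib, Finset.sum_comm, Finset.sum_comm (s := X) (t := univ)
    (f := fun v e' => if G.head e' = v then f e' else 0), ← Finset.sum_sub_distrib] at h1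
  simp only [Finset.sum_ite_eq] at h1
  have htail : G.tail e ∈ X := by
    simp only [X, mem_filter, mem_univ, true_and]
    exact Relation.ReflTransGen.refl
  have hhead : G.head e ∉ X := by
    simp only [X, mem_filter, mem_univ, true_and]
    exact hbr
  rw [Finset.sum_eq_single e] at h1
  · rw [if_pos htail, if_neg hhead, sub_zero] at h1
    have := (hf e).1
    rw [h1, abs_zero] at this
    linarith
  · intro e' _ hne
    have hiff : G.tail e' ∈ X ↔ G.head e' ∈ X := by
      simp only [X, mem_filter, mem_univ, true_and]
      constructor
      · intro h
        exact Relation.ReflTransGen.tail h ⟨⟨e', hne⟩, Or.inl rfl⟩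
      · intro h
        exact Relation.ReflTransGen.tail h ⟨⟨e', hne⟩, Or.inr rfl⟩
    by_cases h : G.tail e' ∈ X
    · rw [if_pos h, if_pos (hiff.1 h), sub_self]
    · rw [if_neg h, if_neg (fun h' => h (hiff.2 h')), sub_self]
  · simp

/-- Local analysis at a vertex, the case of many positive terms. -/
theorem local_pos {E : Type} (t : ℕ) (ht : 1 ≤ t) (I : Finset E) (a : E → ℝ) (ρ : ℝ)
    (hρ : ρ < (2 * t + 1) / (2 * t - 1)) (hI : #I = 2 * t + 1)
    (ha : ∀ e ∈ I, 1 ≤ |a e| ∧ |a e| ≤ ρ) (h0 : ∑ e ∈ I, a e = 0)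
    (hp : t + 1 ≤ #{e ∈ I | 0 < a e}) :
    (∀ e ∈ I, 0 < a e → a e < 2 * t / (2 * t - 1)) ∧
    (∀ e ∈ I, a e < 0 → a e ≤ - (2 * t / (2 * t - 1))) := by
  classical
  have ht' : (1 : ℝ) ≤ t := by exact_mod_cast ht
  have hd : (0 : ℝ) < 2 * t - 1 := by linarith
  set P := {e ∈ I | 0 < a e} with hP
  set Q := {e ∈ I | ¬ 0 < a e} with hQ
  have hPQ : #P + #Q = 2 * t + 1 := by
    rw [← hI]; exact Finset.card_filter_add_card_filter_not _
  have hsum : ∑ e ∈ P, a e = ∑ e ∈ Q, - a e := by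
    have := Finset.sum_filter_add_sum_filter_not I (fun e => 0 < a e) a
    rw [h0] at this
    rw [Finset.sum_neg_distrib]
    linarith
  have hPb : ∀ e ∈ P, 1 ≤ a e ∧ a e ≤ ρ := by
    intro e he
    rw [hP, mem_filter] at he
    have := ha e he.1
    rwa [abs_of_pos he.2] at this
  have hQb : ∀ e ∈ Q, 1 ≤ - a e ∧ - a e ≤ ρ := by
    intro e he
    rw [hQ, mem_filter] at he
    have := ha e he.1
    rwa [abs_of_nonpos (not_lt.1 he.2)] at this
  have hQt : (#Q : ℝ) ≤ t := by exact_mod_cast (by omega : #Q ≤ t)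
  have hPt : (t : ℝ) + 1 ≤ #P := by exact_mod_cast hp
  have hρ1 : 1 ≤ ρ := by
    obtain ⟨e, he⟩ := Finset.card_pos.1 (by omega : 0 < #P)
    linarith [(hPb e he).1, (hPb e he).2]
  rw [lt_div_iff₀ hd] at hρ
  have hSP : (#P : ℝ) ≤ ∑ e ∈ P, a e := by
    have := Finset.card_nsmul_le_sum P a 1 (fun e he => (hPb e he).1)
    simpa using this
  have hSQ : ∑ e ∈ Q, - a e ≤ #Q * ρ := by
    have := Finset.sum_le_card_nsmul Q (fun e => - a e) ρ (fun e he => (hQb e he).2)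
    simpa using this
  constructor
  · intro e he hpos
    have heP : e ∈ P := by rw [hP, mem_filter]; exact ⟨he, hpos⟩
    have h1 : a e + ((#P : ℝ) - 1) ≤ ∑ e ∈ P, a e := by
      rw [← Finset.add_sum_erase P a heP]
      have := Finset.card_nsmul_le_sum (P.erase e) a 1
        (fun e he => (hPb e (Finset.mem_of_mem_erase he)).1)
      rw [Finset.card_erase_of_mem heP, nsmul_eq_mul, mul_one,
        Nat.cast_sub (by omega : 1 ≤ #P)] at this
      push_cast at this
      linarith
    rw [lt_div_iff₀ hd]
    have h2 : a e ≤ t * ρ - t := by nlinarith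
    nlinarith
  · intro e he hneg
    have heQ : e ∈ Q := by rw [hQ, mem_filter]; exact ⟨he, not_lt.2 hneg.le⟩
    have hQ1 : 1 ≤ #Q := Finset.card_pos.2 ⟨e, heQ⟩
    have h1 : ∑ e ∈ Q, - a e ≤ - a e + ((#Q : ℝ) - 1) * ρ := by
      rw [← Finset.add_sum_erase Q _ heQ]
      have := Finset.sum_le_card_nsmul (Q.erase e) (fun e => - a e) ρ
        (fun e he => (hQb e (Finset.mem_of_mem_erase he)).2)
      rw [Finset.card_erase_of_mem heQ, nsmul_eq_mul, Nat.cast_sub hQ1] at this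
      push_cast at this
      linarith
    have h2 : (t : ℝ) + 1 - (t - 1) * ρ ≤ - a e := by nlinarith
    have h3 : 2 * (t : ℝ) / (2 * t - 1) ≤ - a e := by
      rw [div_le_iff₀ hd]
      rcases eq_or_lt_of_le ht' with h | h
      · rw [← h] at h2 hρ ⊢
        nlinarith
      · nlinarith [mul_lt_mul_of_pos_left hρ (by linarith : (0 : ℝ) < t - 1)]
    linarith

end Multigraph

namespace Multigraph

open Finset

theorem bipartite_of_flow (G : Multigraph) (t : ℕ) (ht : 1 ≤ t) (hr : G.IsRegular (2 * t + 1))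
    {r : ℝ} (hlt : r < 2 + 2 / (2 * (t : ℝ) - 1)) (h : G.HasNZFlow r) : G.IsBipartite := by
  classical
  have := Fintype.ofFinite G.E
  obtain ⟨f, hf, hk⟩ := h
  simp only [flow_sum] at hk
  have ht' : (1 : ℝ) ≤ t := by exact_mod_cast ht
  have hd : (0 : ℝ) < 2 * t - 1 := by linarith
  have hρ : r - 1 < (2 * t + 1) / (2 * t - 1) := by
    have : (2 * (t : ℝ) + 1) / (2 * t - 1) = 1 + 2 / (2 * t - 1) := by field_simp; ring
    rw [this]; linarith
  let I : G.V → Finset G.E := fun v => {e | G.Inc v e}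
  have hI : ∀ v, #(I v) = 2 * t + 1 := by
    intro v
    rw [← hr v, degree, Nat.card_eq_fintype_card, Fintype.card_subtype]
  let o : G.V → G.E → ℝ := fun v e => if G.tail e = v then f e else - f e
  have ho : ∀ v e, |o v e| = |f e| := by
    intro v e
    by_cases h : G.tail e = v <;> simp [o, h]
  have hb : ∀ v, ∀ e ∈ I v, 1 ≤ |o v e| ∧ |o v e| ≤ r - 1 := by
    intro v e _; rw [ho]; exact hf e
  have h0 : ∀ v, ∑ e ∈ I v, o v e = 0 := by
    intro v
    have := hk v
    rw [← sub_eq_zero, ← Finset.sum_sub_distrib] at this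
    rw [← this, Finset.sum_filter]
    apply Finset.sum_congr rfl
    intro e _
    have hl := G.no_loop e
    change G.tail e ≠ G.head e at hl
    by_cases h1 : G.tail e = v
    · have h2 : G.head e ≠ v := fun h => hl (h1.trans h.symm)
      simp [Inc, o, h1, h2]
    · by_cases h2 : G.head e = v <;> simp [Inc, o, h1, h2]
  let c : ℝ := 2 * t / (2 * t - 1)
  have hdich : ∀ v, ((∀ e ∈ I v, 0 < o v e → o v e < c) ∧ (∀ e ∈ I v, o v e < 0 → o v e ≤ -c)) ∨
      ((∀ e ∈ I v, o v e < 0 → - o v e < c) ∧ (∀ e ∈ I v, 0 < o v e → c ≤ o v e)) := by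
    intro v
    by_cases hp : t + 1 ≤ #{e ∈ I v | 0 < o v e}
    · exact Or.inl (local_pos t ht (I v) (o v) (r - 1) hρ (hI v) (hb v) (h0 v) hp)
    · right
      have hp' : t + 1 ≤ #{e ∈ I v | 0 < (fun e => - o v e) e} := by
        have h1 := Finset.card_filter_add_card_filter_not (s := I v) (fun e => 0 < o v e)
        rw [hI v] at h1
        have h2 : ({e ∈ I v | ¬ 0 < o v e} : Finset G.E) =
            {e ∈ I v | 0 < (fun e => - o v e) e} := by
          apply Finset.filter_congr
          intro e he
          have h3 := (hb v e he).1
          constructor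
          · intro h
            have h4 : o v e ≠ 0 := by
              intro h5; rw [h5, abs_zero] at h3; linarith
            have : o v e < 0 := lt_of_le_of_ne (not_lt.1 h) h4
            simpa using this
          · intro h
            simp only [neg_pos] at h
            exact not_lt.2 h.le
        rw [← h2]
        omega
      obtain ⟨ha, hb'⟩ := local_pos t ht (I v) (fun e => - o v e) (r - 1) hρ (hI v)
        (by intro e he; simpa using hb v e he) (by rw [Finset.sum_neg_distrib, h0 v, neg_zero]) hp'
      refine ⟨fun e he h => ha e he (by simpa using h), fun e he h => ?_⟩
      have := hb' e he (by simpa using h)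
      exact neg_le_neg_iff.1 this
  refine ⟨{v | (∀ e ∈ I v, 0 < o v e → o v e < c) ∧ (∀ e ∈ I v, o v e < 0 → o v e ≤ -c)}, ?_⟩
  intro e hiff
  simp only [Set.mem_ofPred_eq] at hiff
  have hl : G.tail e ≠ G.head e := G.no_loop e
  have hx : o (G.tail e) e = f e := by simp [o]
  have hy : o (G.head e) e = - f e := by simp [o, hl]
  have hex : e ∈ I (G.tail e) := mem_filter.2 ⟨mem_univ _, Or.inl rfl⟩
  have hey : e ∈ I (G.head e) := mem_filter.2 ⟨mem_univ _, Or.inr rfl⟩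
  have hf0 : f e ≠ 0 := by
    intro h
    have := (hf e).1
    rw [h, abs_zero] at this
    linarith
  by_cases hB : (∀ e' ∈ I (G.tail e), 0 < o (G.tail e) e' → o (G.tail e) e' < c) ∧
      (∀ e' ∈ I (G.tail e), o (G.tail e) e' < 0 → o (G.tail e) e' ≤ -c)
  · have hB' := hiff.1 hB
    have h1 := hB.1 e hex
    have h2 := hB.2 e hex
    have h3 := hB'.1 e hey
    have h4 := hB'.2 e hey
    rw [hx] at h1 h2
    rw [hy] at h3 h4
    rcases lt_or_gt_of_ne hf0 with h | h
    · linarith [h2 h, h3 (by linarith)]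
    · linarith [h1 h, h4 (by linarith)]
  · have hB' : ¬ _ := fun h => hB (hiff.2 h)
    have hW := (hdich (G.tail e)).resolve_left hB
    have hW' := (hdich (G.head e)).resolve_left hB'
    have h1 := hW.1 e hex
    have h2 := hW.2 e hex
    have h3 := hW'.1 e hey
    have h4 := hW'.2 e hey
    rw [hx] at h1 h2
    rw [hy] at h3 h4
    rcases lt_or_gt_of_ne hf0 with h | h
    · linarith [h1 h, h4 (by linarith)]
    · linarith [h2 h, h3 (by linarith)]

/-- The lower bound. -/
theorem lower_bound (G : Multigraph) (t : ℕ) (ht : 1 ≤ t) (hr : G.IsRegular (2 * t + 1))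
    (h2 : G.IsClass2) : ((2 + 2 / (2 * (t : ℝ) - 1) : ℝ) : EReal) ≤ G.flowNumber := by
  apply le_sInf
  rintro x ⟨r, rfl, _, hf⟩
  rw [EReal.coe_le_coe_iff]
  by_contra hlt
  exact h2 (G.class1_of_bipartite hr (G.bipartite_of_flow t ht hr (not_le.1 hlt) hf))

end Multigraph

namespace Multigraph

open Finset

/-- The graph built from a set `H` of spokes: every spoke `h` has the two ends `(h, false)` and
`(h, true)`, joined by `m` parallel edges. In addition every vertex `v` is the tail of exactly one
rim edge (labelled `v`) and the head of exactly one rim edge (labelled `P v`). -/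
def rim (H : Type) [Finite H] (P : H × Bool ≃ H × Bool) (hP : ∀ v, P v ≠ v) (m : ℕ) :
    Multigraph where
  V := H × Bool
  E := (H × Bool) ⊕ (H × Fin m)
  vFinite := by infer_instance
  eFinite := by infer_instance
  ends := Sum.elim (fun e => (e, P.symm e)) (fun p => ((p.1, false), (p.1, true)))
  no_loop := by
    rintro (e | ⟨h, j⟩)
    · intro h
      have h' : e = P.symm e := h
      apply hP e
      conv_lhs => rw [h']
      simp
    · simp

section
variable {H : Type} [Finite H] {P : H × Bool ≃ H × Bool} {hP : ∀ v, P v ≠ v} {m : ℕ}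

theorem rim_inc_inl (v e : H × Bool) :
    (rim H P hP m).Inc v (Sum.inl e) ↔ (e = v ∨ e = P v) := by
  change (e = v ∨ P.symm e = v) ↔ _
  rw [Equiv.symm_apply_eq]

theorem rim_inc_inr (v : H × Bool) (h : H) (j : Fin m) :
    (rim H P hP m).Inc v (Sum.inr (h, j)) ↔ h = v.1 := by
  change ((h, false) = v ∨ (h, true) = v) ↔ _
  rcases v with ⟨h', b⟩
  cases b <;> simp

/-- The edges at a vertex of `rim`. -/
noncomputable def rimIncEquiv (v : H × Bool) :
    (Bool ⊕ Fin m) ≃ {e : (rim H P hP m).E // (rim H P hP m).Inc v e} :=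
  Equiv.ofBijective
    (Sum.elim
      (fun b => if b then ⟨Sum.inl v, (rim_inc_inl v v).2 (Or.inl rfl)⟩
        else ⟨Sum.inl (P v), (rim_inc_inl v (P v)).2 (Or.inr rfl)⟩)
      (fun j => ⟨Sum.inr (v.1, j), (rim_inc_inr v v.1 j).2 rfl⟩))
    (by
      constructor
      · rintro (b | j) (b' | j') h
        · cases b <;> cases b' <;> first | rfl | skip
          · exact absurd (Sum.inl_injective (congrArg Subtype.val h)) (hP v)
          · exact absurd (Sum.inl_injective (congrArg Subtype.val h)).symm (hP v)
        · cases b <;> exact absurd (congrArg Subtype.val h) Sum.inl_ne_inr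
        · cases b' <;> exact absurd (congrArg Subtype.val h) Sum.inr_ne_inl
        · have := Sum.inr_injective (congrArg Subtype.val h)
          simp only [Prod.mk.injEq] at this
          rw [this.2]
      · rintro ⟨e | ⟨h, j⟩, he⟩
        · rcases (rim_inc_inl v e).1 he with h | h
          · exact ⟨Sum.inl true, by subst h; rfl⟩
          · exact ⟨Sum.inl false, by subst h; rfl⟩
        · have := (rim_inc_inr v h j).1 he
          subst this
          exact ⟨Sum.inr j, rfl⟩)

theorem rim_regular : (rim H P hP m).IsRegular (m + 2) := by
  intro v
  rw [degree, ← Nat.card_congr (rimIncEquiv (P := P) (hP := hP) (m := m) v)]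
  simp [Nat.card_eq_fintype_card, add_comm]

/-- Two unordered pairs of distinct elements agree. -/
def PairEq {K : Type} (a b x y : K) : Prop := a ≠ b ∧ ((a = x ∧ b = y) ∨ (a = y ∧ b = x))

theorem rim_coloring [Nonempty H] (h : (rim H P hP m).IsClass1) :
    ∃ c : H × Bool → Fin (m + 2), ∀ h : H,
      PairEq (c (h, false)) (c (P (h, false))) (c (h, true)) (c (P (h, true))) := by
  classical
  have : Nonempty (rim H P hP m).V := ⟨(Classical.arbitrary H, false)⟩
  rw [IsClass1, maxDegree_eq _ (rim_regular (P := P) (hP := hP) (m := m))] at h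
  have hne : {k | ∃ c : (rim H P hP m).E → Fin k,
      (rim H P hP m).IsProperEdgeColoring c}.Nonempty := by
    apply Nat.nonempty_of_pos_sInf
    change 0 < (rim H P hP m).chromaticIndex
    rw [h]; omega
  have hmem := Nat.sInf_mem hne
  change (rim H P hP m).chromaticIndex ∈ _ at hmem
  rw [h] at hmem
  obtain ⟨c, hc⟩ := hmem
  refine ⟨fun e => c (Sum.inl e), fun h => ?_⟩
  let D : H → Finset (Fin (m + 2)) := fun h => univ.image (fun j : Fin m => c (Sum.inr (h, j)))
  have hcomp : ∀ v : H × Bool, c (Sum.inl v) ≠ c (Sum.inl (P v)) ∧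
      ({c (Sum.inl v), c (Sum.inl (P v))} : Finset (Fin (m + 2))) = (D v.1)ᶜ := by
    intro v
    have hinj := (coloring_inj _ hc v).comp
      (rimIncEquiv (P := P) (hP := hP) (m := m) v).injective
    have h1 : c (Sum.inl v) ≠ c (Sum.inl (P v)) := by
      intro hh
      have := @hinj (Sum.inl true) (Sum.inl false) hh
      simp at this
    have h2 : ∀ j, c (Sum.inl v) ≠ c (Sum.inr (v.1, j)) := by
      intro j hh
      have := @hinj (Sum.inl true) (Sum.inr j) hh
      simp at this
    have h3 : ∀ j, c (Sum.inl (P v)) ≠ c (Sum.inr (v.1, j)) := by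
      intro j hh
      have := @hinj (Sum.inl false) (Sum.inr j) hh
      simp at this
    have h4 : #(D v.1) = m := by
      rw [Finset.card_image_of_injective]
      · simp
      · intro j j' hh
        have := @hinj (Sum.inr j) (Sum.inr j') hh
        simpa using this
    refine ⟨h1, ?_⟩
    apply Finset.eq_of_subset_of_card_le
    · intro x hx
      rw [mem_compl]
      intro hx'
      obtain ⟨j, _, rfl⟩ := Finset.mem_image.1 hx'
      rw [mem_insert, mem_singleton] at hx
      rcases hx with hx | hx
      · exact h2 j hx.symm
      · exact h3 j hx.symm
    · rw [Finset.card_compl, h4, Finset.card_pair h1]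
      simp
  obtain ⟨a1, a2⟩ := hcomp (h, false)
  obtain ⟨b1, b2⟩ := hcomp (h, true)
  have heq := a2.trans b2.symm
  refine ⟨a1, ?_⟩
  have m1 : c (Sum.inl (h, false)) ∈
      ({c (Sum.inl (h, true)), c (Sum.inl (P (h, true)))} : Finset (Fin (m + 2))) := by
    rw [← heq]; simp
  have m2 : c (Sum.inl (P (h, false))) ∈
      ({c (Sum.inl (h, true)), c (Sum.inl (P (h, true)))} : Finset (Fin (m + 2))) := by
    rw [← heq]; simp
  rw [mem_insert, mem_singleton] at m1 m2
  rcases m1 with m1 | m1 <;> rcases m2 with m2 | m2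
  · exact absurd (m1.trans m2.symm) a1
  · exact Or.inl ⟨m1, m2⟩
  · exact Or.inr ⟨m1, m2⟩
  · exact absurd (m1.trans m2.symm) a1

/-- Values on a bundle of `2t-1` parallel edges with prescribed total flow. -/
theorem bundle (t : ℕ) (ht : 1 ≤ t) (F : ℝ) (h1 : 1 ≤ |F|) (h2 : |F| ≤ 3) :
    ∃ g : Fin (2 * t - 1) → ℝ, (∀ j, 2 * (t : ℝ) - 1 ≤ |g j| ∧ |g j| ≤ 2 * t + 1) ∧
      ∑ j, g j = F := by
  have ht' : (1 : ℝ) ≤ t := by exact_mod_cast ht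
  have key : ∀ F : ℝ, 1 ≤ F → F ≤ 3 →
      ∃ g : Fin (2 * t - 1) → ℝ, (∀ j, 2 * (t : ℝ) - 1 ≤ |g j| ∧ |g j| ≤ 2 * t + 1) ∧
      ∑ j, g j = F := by
    intro F h1 h2
    let l : ℝ := (F - 1) / (4 * t - 2)
    have hd : (0 : ℝ) < 4 * t - 2 := by linarith
    have hl0 : 0 ≤ l := div_nonneg (by linarith) hd.le
    have hl1 : l ≤ 1 := by rw [div_le_one hd]; linarith
    have hl : l * (4 * t - 2) = F - 1 := div_mul_cancel₀ _ hd.ne'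
    obtain ⟨s, rfl⟩ : ∃ s, t = s + 1 := ⟨t - 1, by omega⟩
    push_cast at *
    have hm : 2 * (s + 1) - 1 = (s + 1) + s := by omega
    rw [hm]
    refine ⟨Fin.append (fun _ : Fin (s + 1) => 2 * ((s : ℝ) + 1) - 1 + 2 * l)
      (fun _ : Fin s => - (2 * ((s : ℝ) + 1) + 1 - 2 * l)), ?_, ?_⟩
    · intro j
      refine Fin.addCases (fun i => ?_) (fun i => ?_) j
      · rw [Fin.append_left, abs_of_nonneg (by linarith)]
        constructor <;> linarith
      · rw [Fin.append_right, abs_neg, abs_of_nonneg (by linarith)]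
        constructor <;> linarith
    · rw [Fin.sum_univ_add]
      simp only [Fin.append_left, Fin.append_right, sum_const, card_univ, Fintype.card_fin,
        nsmul_eq_mul]
      push_cast
      linear_combination hl
  rcases le_total 0 F with h | h
  · rw [abs_of_nonneg h] at h1 h2
    exact key F h1 h2
  · rw [abs_of_nonpos h] at h1 h2
    obtain ⟨g, hg, hs⟩ := key (-F) h1 h2
    refine ⟨fun j => - g j, fun j => by simpa using hg j, ?_⟩
    rw [Finset.sum_neg_distrib, hs, neg_neg]

theorem rim_tail_sum (F : (H × Bool) ⊕ (H × Fin m) → ℝ) (v : H × Bool) :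
    ∑ᶠ e ∈ {e | (rim H P hP m).tail e = v}, F e =
      F (Sum.inl v) + if v.2 = false then ∑ j, F (Sum.inr (v.1, j)) else 0 := by
  classical
  have := Fintype.ofFinite H
  let : Fintype (rim H P hP m).E := inferInstanceAs (Fintype ((H × Bool) ⊕ (H × Fin m)))
  have hdec : DecidableEq (H × Bool) := Classical.decEq _
  refine (@flow_sum (rim H P hP m) _ hdec F (rim H P hP m).tail v).trans ?_
  refine (Fintype.sum_sum_type (α₁ := H × Bool) (α₂ := H × Fin m) _).trans ?_
  congr 1
  · change (∑ e : H × Bool, if e = v then F (Sum.inl e) else 0) = _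
    simp
  · change (∑ p : H × Fin m, if (p.1, false) = v then F (Sum.inr p) else 0) = _
    rw [Fintype.sum_prod_type]
    rcases v with ⟨h, b⟩
    cases b
    · rw [Finset.sum_eq_single h]
      · simp
      · intro b _ hb
        simp [hb]
      · simp
    · simp

theorem rim_head_sum (F : (H × Bool) ⊕ (H × Fin m) → ℝ) (v : H × Bool) :
    ∑ᶠ e ∈ {e | (rim H P hP m).head e = v}, F e =
      F (Sum.inl (P v)) + if v.2 = true then ∑ j, F (Sum.inr (v.1, j)) else 0 := by
  classical
  have := Fintype.ofFinite H
  let : Fintype (rim H P hP m).E := inferInstanceAs (Fintype ((H × Bool) ⊕ (H × Fin m)))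
  have hdec : DecidableEq (H × Bool) := Classical.decEq _
  refine (@flow_sum (rim H P hP m) _ hdec F (rim H P hP m).head v).trans ?_
  refine (Fintype.sum_sum_type (α₁ := H × Bool) (α₂ := H × Fin m) _).trans ?_
  congr 1
  · change (∑ e : H × Bool, if P.symm e = v then F (Sum.inl e) else 0) = _
    simp only [Equiv.symm_apply_eq]
    simp
  · change (∑ p : H × Fin m, if (p.1, true) = v then F (Sum.inr p) else 0) = _
    rw [Fintype.sum_prod_type]
    rcases v with ⟨h, b⟩
    cases b
    · simp
    · rw [Finset.sum_eq_single h]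
      · simp
      · intro b _ hb
        simp [hb]
      · simp

theorem rim_flow (t : ℕ) (ht : 1 ≤ t) (z : H × Bool → ℝ) (ε : ℝ) (hε : 0 ≤ ε)
    (hε1 : ε < 2 * t - 1)
    (hz : ∀ v, |z v| ≤ 1 + ε)
    (hs : ∀ h, z (P (h, false)) - z (h, false) = z (h, true) - z (P (h, true)))
    (hs1 : ∀ h, 1 ≤ |z (h, true) - z (P (h, true))|)
    (hs3 : ∀ h, |z (h, true) - z (P (h, true))| ≤ 3) :
    (rim H P hP (2 * t - 1)).HasNZFlow (1 + (2 * t + 1 + ε) / (2 * t - 1 - ε)) := by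
  classical
  have hd : 0 < 2 * t - 1 - ε := by linarith
  choose g hg hgs using fun h => bundle t ht _ (hs1 h) (hs3 h)
  let f : (rim H P hP (2 * t - 1)).E → ℝ :=
    Sum.elim (fun e => 2 * t + z e) (fun p => g p.1 p.2)
  have hf : ∀ e, 2 * t - 1 - ε ≤ |f e| ∧ |f e| ≤ 2 * t + 1 + ε := by
    rintro (e | ⟨h, j⟩)
    · have := abs_le.1 (hz e)
      change _ ≤ |2 * (t : ℝ) + z e| ∧ |2 * (t : ℝ) + z e| ≤ _
      rw [abs_of_nonneg (by linarith)]
      constructor <;> linarith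
    · have := hg h j
      change _ ≤ |g h j| ∧ |g h j| ≤ _
      constructor <;> linarith
  refine ⟨fun e => f e / (2 * t - 1 - ε), ?_, ?_⟩
  · intro e
    obtain ⟨h1, h2⟩ := hf e
    rw [abs_div, abs_of_pos hd, le_div_iff₀ hd, add_sub_cancel_left, one_mul]
    exact ⟨h1, div_le_div_of_nonneg_right h2 hd.le⟩
  · rintro ⟨h, b⟩
    refine (rim_tail_sum (fun e => f e / (2 * t - 1 - ε)) (h, b)).trans ?_
    refine Eq.trans ?_ (rim_head_sum (fun e => f e / (2 * t - 1 - ε)) (h, b)).symm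
    have h1 : ∀ e, f (Sum.inl e) = 2 * t + z e := fun e => rfl
    have h2 : ∀ h j, f (Sum.inr (h, j)) = g h j := fun _ _ => rfl
    simp only [h1, h2, ← Finset.sum_div, hgs]
    cases b
    · simp only [if_true, Bool.false_eq_true, if_false, ← add_div, add_zero]
      congr 1
      linarith [hs h]
    · simp only [if_true, Bool.true_eq_false, if_false, ← add_div, add_zero]
      congr 1
      ring

end

end Multigraph

namespace Multigraph

open Finset

/-- The spokes of the concrete graph: one base spoke and four spokes on each of `n` levels. -/
inductive HV (n : ℕ) : Type
  | base : HV n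
  | v1 : Fin n → HV n
  | v2 : Fin n → HV n
  | v3 : Fin n → HV n
  | v4 : Fin n → HV n

instance HV.finite (n : ℕ) : Finite (HV n) := by
  let f : Option (Fin n ⊕ Fin n ⊕ Fin n ⊕ Fin n) → HV n := fun o =>
    match o with
    | none => HV.base
    | some (Sum.inl i) => HV.v1 i
    | some (Sum.inr (Sum.inl i)) => HV.v2 i
    | some (Sum.inr (Sum.inr (Sum.inl i))) => HV.v3 i
    | some (Sum.inr (Sum.inr (Sum.inr i))) => HV.v4 i
  apply Finite.of_surjective f
  rintro (_ | i | i | i | i)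
  · exact ⟨none, rfl⟩
  · exact ⟨some (Sum.inl i), rfl⟩
  · exact ⟨some (Sum.inr (Sum.inl i)), rfl⟩
  · exact ⟨some (Sum.inr (Sum.inr (Sum.inl i))), rfl⟩
  · exact ⟨some (Sum.inr (Sum.inr (Sum.inr i))), rfl⟩

/-- The `f`-edges (with index shifted by one). -/
def eF (n : ℕ) : ℕ → HV n × Bool
  | 0 => (HV.base, true)
  | 1 => (HV.base, false)
  | k + 2 => if h : k < n then (HV.v2 ⟨k, h⟩, false) else (HV.base, false)

/-- The `e`-edges. -/
def eE (n k : ℕ) : HV n × Bool := if h : k < n then (HV.v4 ⟨k, h⟩, false) else eF n (n + 1)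

/-- The `g`-edges. -/
def eG (n k : ℕ) : HV n × Bool := if h : k < n then (HV.v3 ⟨k, h⟩, true) else eF n n

/-- The rim edge entering a vertex. -/
def inn (n : ℕ) : HV n × Bool → HV n × Bool
  | (HV.base, false) => eE n 0
  | (HV.base, true) => eG n 0
  | (HV.v1 i, false) => eG n (i + 1)
  | (HV.v1 i, true) => (HV.v4 i, true)
  | (HV.v2 i, false) => (HV.v1 i, false)
  | (HV.v2 i, true) => eF n i
  | (HV.v3 i, false) => eE n (i + 1)
  | (HV.v3 i, true) => (HV.v1 i, true)
  | (HV.v4 i, false) => (HV.v3 i, false)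
  | (HV.v4 i, true) => (HV.v2 i, true)

/-- Heads of the `f`-edges. -/
def oF (N k : ℕ) : HV (N + 1) × Bool :=
  if h : k < N + 1 then (HV.v2 ⟨k, h⟩, true)
  else if k = N + 1 then (HV.v1 (Fin.last N), false) else (HV.v3 (Fin.last N), false)

/-- Head of a rim edge. -/
def outv (N : ℕ) : HV (N + 1) × Bool → HV (N + 1) × Bool
  | (HV.base, false) => oF N 1
  | (HV.base, true) => oF N 0
  | (HV.v1 i, false) => (HV.v2 i, false)
  | (HV.v1 i, true) => (HV.v3 i, true)
  | (HV.v2 i, false) => oF N (i + 2)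
  | (HV.v2 i, true) => (HV.v4 i, true)
  | (HV.v3 i, false) => (HV.v4 i, false)
  | (HV.v3 i, true) => if (i : ℕ) = 0 then (HV.base, true) else
      (HV.v1 ⟨i - 1, lt_of_le_of_lt (Nat.sub_le _ _) i.2⟩, false)
  | (HV.v4 i, false) => if (i : ℕ) = 0 then (HV.base, false) else
      (HV.v3 ⟨i - 1, lt_of_le_of_lt (Nat.sub_le _ _) i.2⟩, false)
  | (HV.v4 i, true) => (HV.v1 i, true)

theorem outv_eF (N k : ℕ) (hk : k ≤ N + 2) : outv N (eF (N + 1) k) = oF N k := by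
  match k with
  | 0 => rfl
  | 1 => rfl
  | k + 2 =>
    have : k < N + 1 := by omega
    simp [eF, this, outv]

theorem outv_inn (N : ℕ) : Function.LeftInverse (outv N) (inn (N + 1)) := by
  rintro ⟨_ | i | i | i | i, _ | _⟩
  · simp [inn, eE, outv]
  · simp [inn, eG, outv]
  · simp only [inn, eG]
    split_ifs with h
    · simp [outv]
    · rw [outv_eF _ _ (by omega)]
      have : i = Fin.last N := Fin.ext (by simp only [Fin.val_last]; omega)
      simp [oF, this]
  · rfl
  · rfl
  · simp only [inn]
    rw [outv_eF _ _ (by omega)]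
    exact dif_pos i.2
  · simp only [inn, eE]
    split_ifs with h
    · simp [outv]
    · rw [outv_eF _ _ (by omega)]
      have : i = Fin.last N := Fin.ext (by simp only [Fin.val_last]; omega)
      simp [oF, this]
  · rfl
  · rfl
  · rfl

/-- The rim permutation. -/
noncomputable def innE (N : ℕ) : HV (N + 1) × Bool ≃ HV (N + 1) × Bool :=
  Equiv.ofBijective (inn (N + 1)) (Finite.injective_iff_bijective.1 (outv_inn N).injective)

theorem eF_ne (n k : ℕ) (i : Fin n) : eF n k ≠ (HV.v1 i, false) ∧ eF n k ≠ (HV.v3 i, false) ∧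
    eF n k ≠ (HV.v2 i, true) := by
  match k with
  | 0 => simp [eF]
  | 1 => simp [eF]
  | k + 2 =>
    simp only [eF]
    split_ifs <;> simp

theorem innE_ne (N : ℕ) : ∀ v, innE N v ≠ v := by
  intro v
  change inn (N + 1) v ≠ v
  rcases v with ⟨_ | i | i | i | i, _ | _⟩
  · simp [inn, eE]
  · simp [inn, eG]
  · simp only [inn, eG]
    split_ifs with h
    · simp
    · exact (eF_ne _ _ _).1
  · simp [inn]
  · simp [inn]
  · exact (eF_ne _ _ _).2.2
  · simp only [inn, eE]
    split_ifs with h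
    · simp
    · exact (eF_ne _ _ _).2.1
  · simp [inn]
  · simp [inn]
  · simp [inn]

/-- The inductive step of the colouring argument. -/
theorem pair_step {K : Type} {e f g f' o1 n1 n2 o3 n4 e2 f2 g2 : K}
    (h0 : PairEq e f g f') (h1 : PairEq o1 g2 n1 n4) (h2 : PairEq f2 o1 n2 f')
    (h3 : PairEq o3 e2 g n1) (h4 : PairEq e o3 n4 n2) : PairEq e2 f2 g2 f := by
  unfold PairEq at *
  obtain ⟨a0, h0⟩ := h0
  obtain ⟨a1, h1⟩ := h1
  obtain ⟨a2, h2⟩ := h2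
  obtain ⟨a3, h3⟩ := h3
  obtain ⟨a4, h4⟩ := h4
  rcases h0 with ⟨p0, q0⟩ | ⟨p0, q0⟩ <;> rcases h1 with ⟨p1, q1⟩ | ⟨p1, q1⟩ <;>
  rcases h2 with ⟨p2, q2⟩ | ⟨p2, q2⟩ <;> rcases h3 with ⟨p3, q3⟩ | ⟨p3, q3⟩ <;>
  rcases h4 with ⟨p4, q4⟩ | ⟨p4, q4⟩ <;> grind

theorem no_pairs {K : Type} (N : ℕ) (c : HV (N + 1) × Bool → K)
    (hc : ∀ h, PairEq (c (h, false)) (c (inn (N + 1) (h, false))) (c (h, true))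
      (c (inn (N + 1) (h, true)))) : False := by
  have inv : ∀ k, k ≤ N + 1 → PairEq (c (eE (N + 1) k)) (c (eF (N + 1) (k + 1)))
      (c (eG (N + 1) k)) (c (eF (N + 1) k)) := by
    intro k
    induction k with
    | zero =>
      intro _
      have := hc HV.base
      simp only [inn] at this
      simp only [eF]
      unfold PairEq at *
      grind
    | succ k ih =>
      intro hk
      have hk' : k < N + 1 := by omega
      have h0 := ih (by omega)
      have h1 := hc (HV.v1 ⟨k, hk'⟩)
      have h2 := hc (HV.v2 ⟨k, hk'⟩)
      have h3 := hc (HV.v3 ⟨k, hk'⟩)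
      have h4 := hc (HV.v4 ⟨k, hk'⟩)
      have hE : eE (N + 1) k = (HV.v4 ⟨k, hk'⟩, false) := by simp [eE, hk']
      have hG : eG (N + 1) k = (HV.v3 ⟨k, hk'⟩, true) := by simp [eG, hk']
      have hF : eF (N + 1) (k + 1 + 1) = (HV.v2 ⟨k, hk'⟩, false) := by simp [eF, hk']
      simp only [inn] at h1 h2 h3 h4
      rw [← hE] at h4
      rw [← hG] at h3
      rw [← hF] at h2
      exact pair_step h0 h1 h2 h3 h4
  have := inv (N + 1) le_rfl
  apply this.1
  simp [eE]

/-- The potential defining the flow. -/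
noncomputable def zz (n : ℕ) : HV n × Bool → ℝ
  | (HV.base, false) => 1
  | (HV.base, true) => -(1 + 1 / n)
  | (HV.v1 i, false) => (-1) ^ (i : ℕ) * (1 + 1 / n)
  | (HV.v1 i, true) => -((-1) ^ (i : ℕ) * (1 + 1 / n))
  | (HV.v2 i, false) => -((-1) ^ (i : ℕ) * (1 - ((i : ℕ) + 1) / n))
  | (HV.v2 i, true) => (-1) ^ (i : ℕ) * (1 - 1 / n)
  | (HV.v3 i, false) => -(-1) ^ (i : ℕ)
  | (HV.v3 i, true) => -((-1) ^ (i : ℕ) * (1 / n))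
  | (HV.v4 _, false) => 0
  | (HV.v4 i, true) => -((-1) ^ (i : ℕ) * (1 / n))

theorem zz_eF (n k : ℕ) (hk : k ≤ n + 1) :
    zz n (eF n k) = -((-1) ^ k * (1 - ((k : ℝ) - 1) / n)) := by
  match k with
  | 0 => simp [eF, zz]; ring
  | 1 => simp [eF, zz]
  | k + 2 =>
    have : k < n := by omega
    simp only [eF, this, dif_pos, zz]
    push_cast
    ring

theorem zz_eE (n k : ℕ) (hn : n ≠ 0) (hk : k ≤ n) : zz n (eE n k) = 0 := by
  unfold eE
  split_ifs with h
  · rfl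
  · rw [zz_eF _ _ le_rfl]
    have : (n : ℝ) ≠ 0 := by exact_mod_cast hn
    push_cast
    rw [add_sub_cancel_right, div_self this]
    simp

theorem zz_eG (n k : ℕ) (hn : n ≠ 0) (hk : k ≤ n) :
    zz n (eG n k) = -((-1) ^ k * (1 / n)) := by
  unfold eG
  split_ifs with h
  · rfl
  · rw [zz_eF _ _ (by omega)]
    have : (n : ℝ) ≠ 0 := by exact_mod_cast hn
    have hk' : k = n := by omega
    subst hk'
    rw [sub_div, div_self this]
    ring

theorem zz_bound (n : ℕ) (hn : n ≠ 0) (v : HV n × Bool) : |zz n v| ≤ 1 + 1 / n := by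
  have h0 : (0 : ℝ) < n := by exact_mod_cast Nat.pos_of_ne_zero hn
  have h1 : (0 : ℝ) < 1 / n := by positivity
  have h2 : 1 / (n : ℝ) ≤ 1 := by
    rw [div_le_one h0]; exact_mod_cast Nat.one_le_iff_ne_zero.2 hn
  rcases v with ⟨_ | i | i | i | i, _ | _⟩ <;>
    simp only [zz, abs_neg, abs_mul, abs_pow, abs_one, one_pow, one_mul, abs_zero]
  · linarith
  · rw [abs_of_pos] <;> linarith
  · rw [abs_of_pos]; linarith
  · rw [abs_of_pos]; linarith
  · have h3 : ((i : ℕ) + 1 : ℝ) / n ≤ 1 := by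
      rw [div_le_one h0]; exact_mod_cast i.2
    have h4 : 0 ≤ ((i : ℕ) + 1 : ℝ) / n := by positivity
    rw [abs_of_nonneg] <;> linarith
  · rw [abs_of_nonneg] <;> linarith
  · linarith
  · rw [abs_of_pos] <;> linarith
  · linarith
  · rw [abs_of_pos] <;> linarith

theorem zz_cons (n : ℕ) (hn : n ≠ 0) (h : HV n) :
    zz n (inn n (h, false)) - zz n (h, false) = zz n (h, true) - zz n (inn n (h, true)) := by
  have h0 : (n : ℝ) ≠ 0 := by exact_mod_cast hn
  rcases h with _ | i | i | i | i
  · simp only [inn]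
    rw [zz_eE _ _ hn (by omega), zz_eG _ _ hn (by omega)]
    simp [zz]
  · simp only [inn]
    rw [zz_eG _ _ hn (by omega)]
    simp only [zz]
    ring
  · simp only [inn]
    rw [zz_eF _ _ (by omega)]
    simp only [zz]
    ring
  · simp only [inn]
    rw [zz_eE _ _ hn (by omega)]
    simp only [zz]
    ring
  · simp only [inn, zz]
    ring

theorem zz_jump (n : ℕ) (hn : n ≠ 0) (h : HV n) :
    1 ≤ |zz n (h, true) - zz n (inn n (h, true))| ∧
      |zz n (h, true) - zz n (inn n (h, true))| ≤ 3 := by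
  have h0 : (0 : ℝ) < n := by exact_mod_cast Nat.pos_of_ne_zero hn
  have key : ∃ (k : ℕ) (a : ℝ), 1 ≤ a ∧ a ≤ 3 ∧
      zz n (h, true) - zz n (inn n (h, true)) = (-1) ^ k * a := by
    rcases h with _ | i | i | i | i
    · refine ⟨1, 1, le_rfl, by norm_num, ?_⟩
      simp only [inn]
      rw [zz_eG _ _ hn (by omega)]
      simp only [zz]
      ring
    · refine ⟨i + 1, 1, le_rfl, by norm_num, ?_⟩
      simp only [inn, zz]
      ring
    · have h3 : ((i : ℕ) : ℝ) / n ≤ 1 := by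
        rw [div_le_one h0]; exact_mod_cast i.2.le
      have h4 : 0 ≤ ((i : ℕ) : ℝ) / n := by positivity
      refine ⟨i, 2 - (i : ℕ) / n, by linarith, by linarith, ?_⟩
      simp only [inn]
      rw [zz_eF _ _ (by omega)]
      simp only [zz]
      ring
    · refine ⟨i, 1, le_rfl, by norm_num, ?_⟩
      simp only [inn, zz]
      ring
    · refine ⟨i + 1, 1, le_rfl, by norm_num, ?_⟩
      simp only [inn, zz]
      ring
  obtain ⟨k, a, h1, h3, heq⟩ := key
  rw [heq, abs_mul, abs_pow, abs_neg, abs_one, one_pow, one_mul, abs_of_pos (by linarith)]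
  exact ⟨h1, h3⟩

theorem exists_graph (t : ℕ) (ht : 1 ≤ t) (N : ℕ) (hN : 1 ≤ N) :
    ∃ G : Multigraph, G.Bridgeless ∧ G.IsRegular (2 * t + 1) ∧ G.IsClass2 ∧
      G.flowNumber ≤ ((1 + (2 * t + 1 + 1 / ((N : ℝ) + 1)) / (2 * t - 1 - 1 / ((N : ℝ) + 1)) : ℝ)
        : EReal) := by
  have ht' : (1 : ℝ) ≤ t := by exact_mod_cast ht
  have hN' : (1 : ℝ) ≤ N := by exact_mod_cast hN
  have hlt : 1 / ((N : ℝ) + 1) < 1 := by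
    rw [div_lt_one (by linarith)]; linarith
  have hpos : 0 < 1 / ((N : ℝ) + 1) := by positivity
  have hn : N + 1 ≠ 0 := by omega
  have hflow : (rim (HV (N + 1)) (innE N) (innE_ne N) (2 * t - 1)).HasNZFlow
      (1 + (2 * t + 1 + 1 / ((N : ℝ) + 1)) / (2 * t - 1 - 1 / ((N : ℝ) + 1))) := by
    apply rim_flow t ht (zz (N + 1)) _ hpos.le (by linarith)
    · intro v
      have := zz_bound (N + 1) hn v
      push_cast at this
      exact this
    · exact zz_cons (N + 1) hn
    · exact fun h => (zz_jump (N + 1) hn h).1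
    · exact fun h => (zz_jump (N + 1) hn h).2
  refine ⟨_, bridgeless_of_flow _ hflow, ?_, ?_, ?_⟩
  · have := rim_regular (H := HV (N + 1)) (P := innE N) (hP := innE_ne N) (m := 2 * t - 1)
    have h2 : 2 * t - 1 + 2 = 2 * t + 1 := by omega
    rwa [h2] at this
  · intro h
    have : Nonempty (HV (N + 1)) := ⟨HV.base⟩
    obtain ⟨c, hc⟩ := rim_coloring h
    exact no_pairs N c hc
  · apply sInf_le
    refine ⟨_, rfl, ?_, hflow⟩
    have : 1 ≤ (2 * t + 1 + 1 / ((N : ℝ) + 1)) / (2 * t - 1 - 1 / ((N : ℝ) + 1)) := by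
      rw [le_div_iff₀ (by linarith)]
      linarith
    linarith

end Multigraph


/-- For every integer `t ≥ 1`,
`Φ⁽²⁾(2t+1) = inf{φ_c(G) : G bridgeless (2t+1)-regular class 2} = 2 + 2/(2t-1)`. -/
theorem statement_0 (t : ℕ) (ht : 1 ≤ t) :
    sInf {x : EReal | ∃ G : Multigraph,
        G.Bridgeless ∧ G.IsRegular (2 * t + 1) ∧ G.IsClass2 ∧ G.flowNumber = x}
      = ((2 + 2 / (2 * (t : ℝ) - 1) : ℝ) : EReal) := by
  have ht' : (1 : ℝ) ≤ t := by exact_mod_cast ht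
  apply le_antisymm
  · have htend : Filter.Tendsto
        (fun N : ℕ => 1 + (2 * (t : ℝ) + 1 + 1 / ((N : ℝ) + 1)) / (2 * t - 1 - 1 / ((N : ℝ) + 1)))
        Filter.atTop (nhds (1 + (2 * (t : ℝ) + 1 + 0) / (2 * t - 1 - 0))) := by
      have h0 := tendsto_one_div_add_atTop_nhds_zero_nat (𝕜 := ℝ)
      exact ((h0.const_add _).div (h0.const_sub _) (by linarith)).const_add _
    have hval : 1 + (2 * (t : ℝ) + 1 + 0) / (2 * t - 1 - 0) = 2 + 2 / (2 * (t : ℝ) - 1) := by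
      have : 2 * (t : ℝ) - 1 ≠ 0 := by linarith
      field_simp
      ring
    rw [hval] at htend
    rw [← EReal.le_of_forall_lt_iff_le]
    intro z hz
    rw [EReal.coe_lt_coe_iff] at hz
    obtain ⟨N, hN1, hN2⟩ :=
      ((htend.eventually (gt_mem_nhds hz)).and (Filter.eventually_ge_atTop 1)).exists
    obtain ⟨G, hb, hr, hc, hf⟩ := Multigraph.exists_graph t ht N hN2
    refine le_trans (sInf_le (a := G.flowNumber) ?_) (hf.trans ?_)
    · exact ⟨G, hb, hr, hc, rfl⟩
    · exact_mod_cast hN1.le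
  · apply le_sInf
    rintro x ⟨G, -, hr, hc, rfl⟩
    exact G.lower_bound t ht hr hc
end

section
/- For every integer t ≥ 2, the infimum of the circular flow numbers of graphs in 𝒢_{2t+1} equals 2 + 2/(2t−1); that is, Φ^(1)(2t+1) = 2 + 2/(2t−1). -/
namespace Multigraph

/-! ### Generic facts -/

lemma aux_maxDegree {G : Multigraph} {k : ℕ} (h : G.IsRegular k) [Nonempty G.V] :
    G.maxDegree = k := by
  unfold maxDegree
  have : G.degree = fun _ => k := funext h
  rw [this, Set.range_const, csSup_singleton]

lemma aux_color_inj {G : Multigraph} {k : ℕ} {c : G.E → Fin k} (hc : G.IsProperEdgeColoring c)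
    (v : G.V) : Function.Injective (fun e : {e : G.E // G.Inc v e} => c e.1) := by
  intro e e' h
  by_contra hne
  exact hc e.1 e'.1 ⟨fun h' => hne (Subtype.ext h'), v, e.2, e'.2⟩ h

lemma aux_exists_pm {G : Multigraph} {k : ℕ} (hk : 0 < k) (h : G.IsRegular k)
    (h1 : G.IsClass1) : ∃ M : Set G.E, G.IsPerfectMatching M := by
  by_cases hV : Nonempty G.V
  · have h2 : G.chromaticIndex = k := by rw [h1, aux_maxDegree h]
    have hne : {k | ∃ c : G.E → Fin k, G.IsProperEdgeColoring c}.Nonempty := by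
      by_contra hcon
      rw [Set.not_nonempty_iff_eq_empty] at hcon
      unfold chromaticIndex at h2
      rw [hcon, Nat.sInf_empty] at h2
      omega
    have h3 := Nat.sInf_mem hne
    have h4 : sInf {k | ∃ c : G.E → Fin k, G.IsProperEdgeColoring c} = k := h2
    rw [h4] at h3
    obtain ⟨c, hc⟩ := h3
    refine ⟨{e | c e = ⟨0, hk⟩}, fun v => ?_⟩
    have hinj := aux_color_inj hc v
    have hbij : Function.Bijective (fun e : {e : G.E // G.Inc v e} => c e.1) := by
      rw [Nat.bijective_iff_injective_and_card]
      refine ⟨hinj, ?_⟩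
      rw [Nat.card_fin]
      exact h v
    obtain ⟨e, he⟩ := hbij.2 ⟨0, hk⟩
    refine ⟨e.1, ⟨he, e.2⟩, ?_⟩
    rintro e' ⟨h5, h6⟩
    have := @hinj ⟨e', h6⟩ e (by simpa using h5.trans he.symm)
    exact congrArg Subtype.val this
  · exact ⟨∅, fun v => (hV ⟨v⟩).elim⟩

lemma aux_ineq {ι : Type} (I : Finset ι) (g : ι → ℝ) (q : ℝ) (t : ℕ)
    (hb : ∀ e ∈ I, 1 ≤ |g e| ∧ |g e| ≤ q) (hs : ∑ e ∈ I, g e = 0)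
    (hP : (I.filter (fun e => 0 < g e)).card = t + 1)
    (hN : (I.filter (fun e => ¬ 0 < g e)).card = t) (e₀ : ι) (he : e₀ ∈ I) :
    (0 < g e₀ → g e₀ ≤ q * t - t) ∧ (g e₀ < 0 → (t : ℝ) + 1 - q * (t - 1) ≤ - g e₀) := by
  classical
  rw [← Finset.sum_filter_add_sum_filter_not I (fun e => 0 < g e)] at hs
  have hPb : ∀ e ∈ I.filter (fun e => 0 < g e), 1 ≤ g e := by
    intro e h
    rw [Finset.mem_filter] at h
    have := (hb e h.1).1
    rwa [abs_of_pos h.2] at this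
  have hNb : ∀ e ∈ I.filter (fun e => ¬ 0 < g e), -q ≤ g e := by
    intro e h
    rw [Finset.mem_filter] at h
    have := (hb e h.1).2
    linarith [neg_abs_le (g e)]
  constructor
  · intro h0
    have hm : e₀ ∈ I.filter (fun e => 0 < g e) := by simp [he, h0]
    rw [← Finset.add_sum_erase _ _ hm] at hs
    have h1 := Finset.card_nsmul_le_sum ((I.filter (fun e => 0 < g e)).erase e₀) g 1
      (fun e h => hPb e (Finset.mem_of_mem_erase h))
    have h2 := Finset.card_nsmul_le_sum _ g (-q) hNb
    rw [Finset.card_erase_of_mem hm, hP] at h1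
    rw [hN] at h2
    simp only [nsmul_eq_mul, Nat.add_sub_cancel] at h1 h2
    linarith
  · intro h0
    have hm : e₀ ∈ I.filter (fun e => ¬ 0 < g e) := by simp [he, h0.le]
    rw [← Finset.add_sum_erase _ _ hm] at hs
    have h1 := Finset.card_nsmul_le_sum _ g 1 hPb
    have h2 := Finset.card_nsmul_le_sum ((I.filter (fun e => ¬ 0 < g e)).erase e₀) g (-q)
      (fun e h => hNb e (Finset.mem_of_mem_erase h))
    have ht : 1 ≤ t := by
      rw [← hN]; exact Finset.card_pos.2 ⟨_, hm⟩
    rw [Finset.card_erase_of_mem hm, hN] at h2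
    rw [hP] at h1
    simp only [nsmul_eq_mul, Nat.cast_sub ht] at h1 h2
    push_cast at h1 h2
    linarith

lemma aux_card {ι : Type} (I : Finset ι) (g : ι → ℝ) (q : ℝ) (t : ℕ) (ht : 1 ≤ t)
    (hq : q * (2 * t - 1) < 2 * t + 1)
    (hb : ∀ e ∈ I, 1 ≤ |g e| ∧ |g e| ≤ q) (hs : ∑ e ∈ I, g e = 0)
    (hI : I.card = 2 * t + 1) :
    (I.filter (fun e => 0 < g e)).card ≤ t + 1 := by
  have hc := Finset.card_filter_add_card_filter_not (s := I) (fun e => 0 < g e)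
  rw [← Finset.sum_filter_add_sum_filter_not I (fun e => 0 < g e)] at hs
  have h1 := Finset.card_nsmul_le_sum (I.filter (fun e => 0 < g e)) g 1 (by
    intro e h
    rw [Finset.mem_filter] at h
    have := (hb e h.1).1
    rwa [abs_of_pos h.2] at this)
  have h2 := Finset.card_nsmul_le_sum (I.filter (fun e => ¬ 0 < g e)) g (-q) (by
    intro e h
    rw [Finset.mem_filter] at h
    have := (hb e h.1).2
    linarith [neg_abs_le (g e)])
  by_contra hcon
  push Not at hcon
  set a := (I.filter (fun e => 0 < g e)).card
  set b := (I.filter (fun e => ¬ 0 < g e)).card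
  simp only [nsmul_eq_mul] at h1 h2
  have h3 : (a : ℝ) + b = 2 * t + 1 := by rw [hI] at hc; exact_mod_cast hc
  have h4 : (t : ℝ) + 2 ≤ a := by exact_mod_cast hcon
  have h5 : (a : ℝ) ≤ q * b := by linarith
  have ht' : (1 : ℝ) ≤ t := by exact_mod_cast ht
  have hq0 : 0 ≤ q := by
    by_contra hq0
    push Not at hq0
    have hb0 : (0 : ℝ) ≤ b := Nat.cast_nonneg b
    nlinarith
  have h6 : q * b ≤ q * (t - 1) := mul_le_mul_of_nonneg_left (by linarith) hq0
  have h7 : q * (t - 1) * (2 * t - 1) ≤ (t - 1) * (2 * t + 1) := by nlinarith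
  nlinarith

/-- The signed flow leaving `v` through `e`. -/
noncomputable def outFlow (G : Multigraph) (f : G.E → ℝ) (v : G.V) (e : G.E) : ℝ :=
  open Classical in if G.tail e = v then f e else - f e

open Classical in
lemma aux_sum {G : Multigraph} [Fintype G.E] {r : ℝ} {f : G.E → ℝ} (hf : G.IsNZFlow r f)
    (v : G.V) : ∑ e ∈ Finset.univ.filter (fun e => G.Inc v e), G.outFlow f v e = 0 := by
  have h := hf.2 v
  rw [finsum_mem_eq_finite_toFinset_sum _ (Set.toFinite _),
    finsum_mem_eq_finite_toFinset_sum _ (Set.toFinite _)] at h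
  have h1 : (Set.toFinite {e | G.tail e = v}).toFinset
      = Finset.univ.filter (fun e => G.tail e = v) := by ext; simp
  have h2 : (Set.toFinite {e | G.head e = v}).toFinset
      = Finset.univ.filter (fun e => G.head e = v) := by ext; simp
  rw [h1, h2, Finset.sum_filter, Finset.sum_filter] at h
  rw [Finset.sum_filter]
  refine Eq.trans ?_ (sub_eq_zero.2 h)
  rw [← Finset.sum_sub_distrib]
  refine Finset.sum_congr rfl fun e _ => ?_
  have hl : G.tail e ≠ G.head e := G.no_loop e
  unfold outFlow Inc
  by_cases ha : G.tail e = v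
  · have hb : G.head e ≠ v := fun hb => hl (ha.trans hb.symm)
    simp [ha, hb]
  · by_cases hb : G.head e = v <;> simp [ha, hb]

lemma aux_bip {G : Multigraph} {t : ℕ} (ht : 1 ≤ t) (hr : G.IsRegular (2 * t + 1)) {r : ℝ}
    (hq : (r - 1) * (2 * t - 1) < 2 * t + 1) (hf : G.HasNZFlow r) :
    ∃ s : Set G.V, ∀ e, ¬ (G.tail e ∈ s ↔ G.head e ∈ s) := by
  classical
  obtain ⟨f, hf⟩ := hf
  have : Fintype G.E := Fintype.ofFinite _
  let I : G.V → Finset G.E := fun v => Finset.univ.filter (fun e => G.Inc v e)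
  let g := G.outFlow f
  have hI : ∀ v, (I v).card = 2 * t + 1 := by
    intro v
    rw [← hr v, degree, Nat.card_eq_fintype_card, Fintype.card_subtype]
  have hs : ∀ v, ∑ e ∈ I v, g v e = 0 := aux_sum hf
  have habs : ∀ v e, |g v e| = |f e| := by
    intro v e
    simp only [g, outFlow]
    split_ifs <;> simp
  have hb : ∀ v, ∀ e ∈ I v, 1 ≤ |g v e| ∧ |g v e| ≤ r - 1 := by
    intro v e _
    rw [habs]; exact hf.1 e
  have hs' : ∀ v, ∑ e ∈ I v, -g v e = 0 := by
    intro v; rw [Finset.sum_neg_distrib, hs, neg_zero]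
  have hb' : ∀ v, ∀ e ∈ I v, 1 ≤ |-g v e| ∧ |-g v e| ≤ r - 1 := by
    intro v e h
    rw [abs_neg]; exact hb v e h
  have hneg : ∀ v, (I v).filter (fun e => ¬ 0 < g v e) = (I v).filter (fun e => 0 < -g v e) := by
    intro v
    refine Finset.filter_congr fun e he => ?_
    have h1 := (hb v e he).1
    have h2 : g v e ≠ 0 := by
      intro h; rw [h, abs_zero] at h1; linarith
    rw [not_lt, neg_pos]
    exact ⟨fun h => lt_of_le_of_ne h h2, le_of_lt⟩
  have hneg' : ∀ v, (I v).filter (fun e => ¬ 0 < -g v e) = (I v).filter (fun e => 0 < g v e) := by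
    intro v
    have := hneg v
    ext e
    have h3 := Finset.ext_iff.1 this e
    simp only [Finset.mem_filter] at h3 ⊢
    tauto
  have hc1 : ∀ v, ((I v).filter (fun e => 0 < g v e)).card ≤ t + 1 :=
    fun v => aux_card _ _ _ t ht hq (hb v) (hs v) (hI v)
  have hc2 : ∀ v, ((I v).filter (fun e => 0 < -g v e)).card ≤ t + 1 :=
    fun v => aux_card _ _ _ t ht hq (hb' v) (hs' v) (hI v)
  have hc : ∀ v, ((I v).filter (fun e => 0 < g v e)).card
      + ((I v).filter (fun e => 0 < -g v e)).card = 2 * t + 1 := by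
    intro v
    rw [← hneg, Finset.card_filter_add_card_filter_not, hI]
  refine ⟨{v | ((I v).filter (fun e => 0 < g v e)).card = t + 1}, fun e hiff => ?_⟩
  have hl : G.tail e ≠ G.head e := G.no_loop e
  have hmu : e ∈ I (G.tail e) := Finset.mem_filter.2 ⟨Finset.mem_univ _, by simp [Inc]⟩
  have hmv : e ∈ I (G.head e) := Finset.mem_filter.2 ⟨Finset.mem_univ _, by simp [Inc]⟩
  have hgu : g (G.tail e) e = f e := by simp [g, outFlow]
  have hgv : g (G.head e) e = - f e := by simp [g, outFlow, hl]
  have hf0 : f e ≠ 0 := by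
    intro h
    have := (hf.1 e).1
    rw [h, abs_zero] at this
    linarith
  simp only [Set.mem_ofPred_eq] at hiff
  by_cases hu : ((I (G.tail e)).filter (fun e' => 0 < g (G.tail e) e')).card = t + 1
  · have hv := hiff.1 hu
    have hu' := hc (G.tail e)
    have hv' := hc (G.head e)
    have k1 := aux_ineq _ _ _ t (hb _) (hs _) hu (by rw [hneg]; omega) e hmu
    have k2 := aux_ineq _ _ _ t (hb _) (hs _) hv (by rw [hneg]; omega) e hmv
    rw [hgu] at k1
    rw [hgv] at k2
    rcases lt_or_gt_of_ne hf0 with h | h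
    · have a1 := k1.2 h
      have a2 := k2.1 (by linarith)
      linarith
    · have a1 := k1.1 h
      have a2 := k2.2 (by linarith)
      linarith
  · have hv := fun h => hu (hiff.2 h)
    have hu' := hc (G.tail e)
    have hv' := hc (G.head e)
    have u1 := hc1 (G.tail e)
    have u2 := hc2 (G.tail e)
    have v1 := hc1 (G.head e)
    have v2 := hc2 (G.head e)
    have k1 := aux_ineq _ _ _ t (hb' _) (hs' _) (by omega) (by rw [hneg']; omega) e hmu
    have k2 := aux_ineq _ _ _ t (hb' _) (hs' _) (by omega) (by rw [hneg']; omega) e hmv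
    rw [hgu] at k1
    rw [hgv] at k2
    rcases lt_or_gt_of_ne hf0 with h | h
    · have a1 := k1.1 (by linarith)
      have a2 := k2.2 (by linarith)
      linarith
    · have a1 := k1.2 (by linarith)
      have a2 := k2.1 (by linarith)
      linarith

lemma aux_lower {G : Multigraph} {t : ℕ} (ht : 2 ≤ t) (hr : G.IsRegular (2 * t + 1))
    (h1 : G.IsClass1)
    (hno : ¬ ∃ M : Set G.E, G.IsPerfectMatching M ∧ (G.deleteEdges M).IsBipartite) :
    ((2 + 2 / (2 * (t : ℝ) - 1) : ℝ) : EReal) ≤ G.flowNumber := by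
  unfold flowNumber
  apply le_sInf
  rintro x ⟨r, rfl, _, hf⟩
  rw [EReal.coe_le_coe_iff]
  by_contra hcon
  push Not at hcon
  have ht' : (2 : ℝ) ≤ t := by exact_mod_cast ht
  have hpos : (0 : ℝ) < 2 * t - 1 := by linarith
  have hq : (r - 1) * (2 * t - 1) < 2 * t + 1 := by
    have h2 : (2 + 2 / (2 * (t : ℝ) - 1) - 1) * (2 * t - 1) = 2 * t + 1 := by
      field_simp
      ring
    nlinarith
  obtain ⟨s, hs⟩ := aux_bip (by omega) hr hq hf
  obtain ⟨M, hM⟩ := aux_exists_pm (by omega) hr h1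
  exact hno ⟨M, hM, s, fun e => hs e.1⟩

end Multigraph

/-! ### Graphs built from a family of fixed-point-free involutions -/

/-- A family (indexed by `K`) of fixed-point-free involutions of a finite set. -/
structure InvFamily (K : Type) : Type 1 where
  V : Type
  fin : Finite V
  σ : K → V → V
  inv : ∀ c v, σ c (σ c v) = v
  ne : ∀ c v, σ c v ≠ v

namespace InvFamily

variable {K : Type} (S : InvFamily K)

instance : Finite S.V := S.fin

/-- An auxiliary injection to the natural numbers, used to choose one end of each edge. -/
noncomputable def o (v : S.V) : ℕ := (Finite.equivFin S.V v : ℕ)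

lemma o_inj : Function.Injective S.o :=
  fun _ _ h => (Finite.equivFin S.V).injective (Fin.ext h)

/-- The edge type: for each colour and orbit, the end with the smaller index. -/
abbrev EE : Type := {p : K × S.V // S.o p.2 < S.o (S.σ p.1 p.2)}

/-- The multigraph whose edges are the orbits of the involutions. -/
@[reducible] noncomputable def graph [Finite K] : Multigraph where
  V := S.V
  E := S.EE
  vFinite := S.fin
  eFinite := by infer_instance
  ends := fun p => (p.1.2, S.σ p.1.1 p.1.2)
  no_loop := fun p => (S.ne p.1.1 p.1.2).symm

lemma lt_of_not {c : K} {v : S.V} (h : ¬ S.o v < S.o (S.σ c v)) :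
    S.o (S.σ c v) < S.o (S.σ c (S.σ c v)) := by
  rw [S.inv]
  rcases lt_trichotomy (S.o v) (S.o (S.σ c v)) with h' | h' | h'
  · exact (h h').elim
  · exact (S.ne c v (S.o_inj h').symm).elim
  · exact h'

/-- The edge of colour `c` at `v`. -/
noncomputable def edge (c : K) (v : S.V) : S.EE :=
  open Classical in
  if h : S.o v < S.o (S.σ c v) then ⟨(c, v), h⟩ else ⟨(c, S.σ c v), S.lt_of_not h⟩

lemma edge_pos {c : K} {v : S.V} (h : S.o v < S.o (S.σ c v)) : S.edge c v = ⟨(c, v), h⟩ :=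
  dif_pos h

lemma edge_neg {c : K} {v : S.V} (h : ¬ S.o v < S.o (S.σ c v)) :
    S.edge c v = ⟨(c, S.σ c v), S.lt_of_not h⟩ :=
  dif_neg h

lemma edge_inc [Finite K] (c : K) (v : S.V) : S.graph.Inc v (S.edge c v) := by
  by_cases h : S.o v < S.o (S.σ c v)
  · rw [S.edge_pos h]; exact Or.inl rfl
  · rw [S.edge_neg h]; exact Or.inr (S.inv c v)

lemma edge_color (c : K) (v : S.V) : (S.edge c v).1.1 = c := by
  by_cases h : S.o v < S.o (S.σ c v)
  · rw [S.edge_pos h]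
  · rw [S.edge_neg h]

lemma eq_edge [Finite K] (v : S.V) (e : S.EE) (h : S.graph.Inc v e) : e = S.edge e.1.1 v := by
  obtain ⟨⟨c, u⟩, hu⟩ := e
  change S.o u < S.o (S.σ c u) at hu
  change u = v ∨ S.σ c u = v at h
  rcases h with rfl | rfl
  · exact (S.edge_pos hu).symm
  · have h' : ¬ S.o (S.σ c u) < S.o (S.σ c (S.σ c u)) := by rw [S.inv]; exact not_lt.2 hu.le
    refine Eq.trans ?_ (S.edge_neg h').symm
    exact Subtype.ext (Prod.ext rfl (S.inv c u).symm)

lemma edge_swap [Finite K] (c : K) (v : S.V) : S.edge c (S.σ c v) = S.edge c v := by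
  have h : S.graph.Inc (S.σ c v) (S.edge c v) := by
    by_cases h : S.o v < S.o (S.σ c v)
    · rw [S.edge_pos h]; exact Or.inr rfl
    · rw [S.edge_neg h]; exact Or.inl rfl
  have := S.eq_edge _ _ h
  rw [S.edge_color] at this
  exact this.symm

lemma regular [Finite K] : S.graph.IsRegular (Nat.card K) := by
  intro v
  unfold Multigraph.degree
  refine Nat.card_congr ⟨fun e => e.1.1.1, fun c => ⟨S.edge c v, S.edge_inc c v⟩, ?_, ?_⟩
  · rintro ⟨e, he⟩
    exact Subtype.ext (S.eq_edge v e he).symm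
  · intro c
    exact S.edge_color c v

lemma class1 [Finite K] [Nonempty S.V] : S.graph.IsClass1 := by
  have : Nonempty S.graph.V := ‹Nonempty S.V›
  unfold Multigraph.IsClass1
  rw [Multigraph.aux_maxDegree S.regular]
  unfold Multigraph.chromaticIndex
  have hmem : Nat.card K ∈ {k | ∃ c : S.graph.E → Fin k, S.graph.IsProperEdgeColoring c} := by
    refine ⟨fun e => Finite.equivFin K e.1.1, ?_⟩
    rintro e e' ⟨hne, v, h1, h2⟩ heq
    apply hne
    rw [S.eq_edge v e h1, S.eq_edge v e' h2, (Finite.equivFin K).injective heq]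
  apply le_antisymm (Nat.sInf_le hmem)
  obtain ⟨c, hc⟩ := Nat.sInf_mem ⟨_, hmem⟩
  obtain ⟨v⟩ := ‹Nonempty S.graph.V›
  have h1 := Nat.card_le_card_of_injective _ (Multigraph.aux_color_inj hc v)
  rw [Nat.card_fin] at h1
  have h2 : Nat.card {e // S.graph.Inc v e} = Nat.card K := S.regular v
  rw [← h2]
  exact h1

lemma noPM [Finite K] (hno : ∀ (N : S.V → K) (s : S.V → Prop), (∀ v, N (S.σ (N v) v) = N v) →
      (∀ v c, c ≠ N v → ¬ (s v ↔ s (S.σ c v))) → False) :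
    ¬ ∃ M : Set S.graph.E, S.graph.IsPerfectMatching M ∧ (S.graph.deleteEdges M).IsBipartite := by
  rintro ⟨M, hM, s, hs⟩
  choose m hm hm' using hM
  have key : ∀ (v : S.V) c, S.edge c v ∈ M → (m v).1.1 = c := by
    intro v c h
    rw [← hm' v (S.edge c v) ⟨h, S.edge_inc c v⟩, S.edge_color]
  have key2 : ∀ v : S.V, S.edge (m v).1.1 v ∈ M := by
    intro v
    rw [← S.eq_edge v (m v) (hm v).2]
    exact (hm v).1
  refine hno (fun v => (m v).1.1) (fun v => v ∈ s) ?_ ?_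
  · intro v
    apply key
    rw [S.edge_swap]
    exact key2 v
  · intro v c hc
    have hn : S.edge c v ∉ M := fun h => hc (key v c h).symm
    have h1 := hs ⟨S.edge c v, hn⟩
    change ¬ ((S.edge c v).1.2 ∈ s ↔ S.σ (S.edge c v).1.1 (S.edge c v).1.2 ∈ s) at h1
    by_cases h : S.o v < S.o (S.σ c v)
    · rw [S.edge_pos h] at h1
      exact h1
    · rw [S.edge_neg h] at h1
      simp only [S.inv] at h1
      intro h2
      exact h1 h2.symm

lemma hasFlow [Fintype K] (F : K → S.V → ℝ) (r : ℝ) (hanti : ∀ c v, F c (S.σ c v) = - F c v)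
    (hb : ∀ c v, 1 ≤ |F c v| ∧ |F c v| ≤ r - 1) (hs : ∀ v, ∑ c, F c v = 0) :
    S.graph.HasNZFlow r := by
  classical
  refine ⟨fun e => F e.1.1 e.1.2, fun e => hb _ _, fun v => ?_⟩
  change S.V at v
  have h1 : ∑ᶠ e ∈ {e | S.graph.tail e = v}, F e.1.1 e.1.2
      = ∑ᶠ c ∈ {c | S.o v < S.o (S.σ c v)}, F c v := by
    refine finsum_mem_eq_of_bijOn (fun e : S.EE => e.1.1) ⟨?_, ?_, ?_⟩ ?_
    · rintro ⟨⟨c, u⟩, hu⟩ rfl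
      exact hu
    · intro e he e' he' h
      rw [S.eq_edge v e (Or.inl he), S.eq_edge v e' (Or.inl he')]
      exact congrArg (fun c => S.edge c v) h
    · intro c hc
      exact ⟨⟨(c, v), hc⟩, rfl, rfl⟩
    · rintro ⟨⟨c, u⟩, hu⟩ rfl
      rfl
  have h2 : ∑ᶠ e ∈ {e | S.graph.head e = v}, F e.1.1 e.1.2
      = ∑ᶠ c ∈ {c | ¬ S.o v < S.o (S.σ c v)}, - F c v := by
    refine finsum_mem_eq_of_bijOn (fun e : S.EE => e.1.1) ⟨?_, ?_, ?_⟩ ?_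
    · rintro ⟨⟨c, u⟩, hu⟩ rfl
      change ¬ S.o (S.σ c u) < S.o (S.σ c (S.σ c u))
      rw [S.inv]
      exact not_lt.2 (le_of_lt hu)
    · intro e he e' he' h
      rw [S.eq_edge v e (Or.inr he), S.eq_edge v e' (Or.inr he')]
      exact congrArg (fun c => S.edge c v) h
    · intro c hc
      exact ⟨⟨(c, S.σ c v), S.lt_of_not hc⟩, S.inv c v, rfl⟩
    · rintro ⟨⟨c, u⟩, hu⟩ rfl
      change F c u = - F c (S.σ c u)
      rw [hanti, neg_neg]
  rw [h1, h2, finsum_mem_eq_finite_toFinset_sum _ (Set.toFinite _),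
    finsum_mem_eq_finite_toFinset_sum _ (Set.toFinite _)]
  have h3 : (Set.toFinite {c | S.o v < S.o (S.σ c v)}).toFinset
      = Finset.univ.filter (fun c => S.o v < S.o (S.σ c v)) := by ext; simp
  have h4 : (Set.toFinite {c | ¬ S.o v < S.o (S.σ c v)}).toFinset
      = Finset.univ.filter (fun c => ¬ S.o v < S.o (S.σ c v)) := by ext; simp
  have h5 := hs v
  rw [← Finset.sum_filter_add_sum_filter_not Finset.univ (fun c => S.o v < S.o (S.σ c v))] at h5
  rw [h3, h4, Finset.sum_neg_distrib]
  linarith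

end InvFamily

/-! ### The concrete family -/

namespace Constr

/-- Vertex types of one half of the graph. -/
inductive T (m : ℕ) : Type
  | s (i : Fin (m + 1))
  | n (i : Fin (m + 1))
  | w (i : Fin (m + 1))
  | u (i : Fin (m + 1))
  | x
  | W
  | U

/-- An enumeration of the vertex types. -/
def T.ofSum (m : ℕ) : (Fin 4 × Fin (m + 1)) ⊕ Fin 3 → T m
  | .inl (0, i) => .s i
  | .inl (1, i) => .n i
  | .inl (2, i) => .w i
  | .inl (3, i) => .u i
  | .inr 0 => .x
  | .inr 1 => .W
  | .inr 2 => .U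

instance (m : ℕ) : Finite (T m) := by
  apply Finite.of_surjective (T.ofSum m)
  rintro (i | i | i | i | _ | _ | _)
  · exact ⟨.inl (0, i), rfl⟩
  · exact ⟨.inl (1, i), rfl⟩
  · exact ⟨.inl (2, i), rfl⟩
  · exact ⟨.inl (3, i), rfl⟩
  · exact ⟨.inr 0, rfl⟩
  · exact ⟨.inr 1, rfl⟩
  · exact ⟨.inr 2, rfl⟩

/-- The vertices: two copies of `T m`. -/
abbrev V (m : ℕ) : Type := T m × Bool

/-- The colours: `2τ + 2` colours of the first kind, and three others. -/
abbrev K (τ : ℕ) : Type := (Fin (τ + 1) × Bool) ⊕ Fin 3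

variable {m : ℕ}

/-- The involution of the colours of the first kind. -/
def σa : V m → V m
  | (.s i, b) => (.w i, b)
  | (.w i, b) => (.s i, b)
  | (.u i, b) => (.u i, !b)
  | (.n i, b) => if i = 0 then (.x, b) else (.n i, !b)
  | (.x, b) => (.n 0, b)
  | (.W, b) => (.U, !b)
  | (.U, b) => (.W, !b)

/-- The involution of the colour `γ`. -/
def σg : V m → V m
  | (.s i, b) => (.w i, b)
  | (.w i, b) => (.s i, b)
  | (.u i, b) => (.u i, !b)
  | (.n i, b) => if i = 0 then (.x, b) else (.n i, !b)
  | (.x, b) => (.n 0, b)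
  | (.W, b) => (.U, b)
  | (.U, b) => (.W, b)

/-- The involution of the colour `d`. -/
def σd : V m → V m
  | (.s i, b) => (.n i, b)
  | (.n i, b) => (.s i, b)
  | (.w i, b) => (.u i, b)
  | (.u i, b) => (.w i, b)
  | (.x, b) => (.W, b)
  | (.W, b) => (.x, b)
  | (.U, b) => (.U, !b)

/-- The involution of the colour `e`. -/
def σe : V m → V m
  | (.s i, b) => (.n (i + 1), b)
  | (.n i, b) => (.s (i - 1), b)
  | (.w i, b) => (.u i, !b)
  | (.u i, b) => (.w i, !b)
  | (.x, b) => (.W, b)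
  | (.W, b) => (.x, b)
  | (.U, b) => (.U, !b)

/-- All involutions. -/
def σ {τ : ℕ} : K τ → V m → V m
  | .inl _ => σa
  | .inr 0 => σg
  | .inr 1 => σd
  | .inr 2 => σe

/-- The family of involutions. -/
def fam (τ m : ℕ) : InvFamily (K τ) where
  V := V m
  fin := inferInstance
  σ := σ
  inv := by
    rintro (c | c) ⟨v, b⟩
    · cases v <;> simp [σ, σa] <;> split_ifs <;> simp_all
    · fin_cases c
      · cases v <;> simp [σ, σg] <;> split_ifs <;> simp_all
      · cases v <;> simp [σ, σd]
      · cases v <;> simp [σ, σe]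
  ne := by
    rintro (c | c) ⟨v, b⟩
    · cases v <;> simp [σ, σa] <;> split_ifs <;> simp_all
    · fin_cases c
      · cases v <;> simp [σ, σg] <;> split_ifs <;> simp_all
      · cases v <;> simp [σ, σd]
      · cases v <;> simp [σ, σe]

lemma fam_noPM (τ m : ℕ) (N : V m → K τ) (s : V m → Prop)
    (hN : ∀ v, N (σ (N v) v) = N v)
    (hs : ∀ v c, c ≠ N v → ¬ (s v ↔ s (σ c v))) : False := by
  -- two distinct colours with the same partner force bichromaticity
  have h2 : ∀ (v : V m) (c c' : K τ), c ≠ c' → σ c v = σ c' v → ¬ (s v ↔ s (σ c v)) := by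
    intro v c c' hc h
    by_cases h1 : c = N v
    · rw [h]; exact hs v c' (fun h3 => hc (h1.trans h3.symm))
    · exact hs v c h1
  -- the vertices `w i` are matched by `d` or `e`
  have hw : ∀ i, N (.w i, false) = .inr 1 ∨ N (.w i, false) = .inr 2 := by
    intro i
    by_contra hcon
    push Not at hcon
    have h3 := hs (.w i, false) (.inr 1) (Ne.symm hcon.1)
    have h4 := hs (.w i, false) (.inr 2) (Ne.symm hcon.2)
    have h5 := h2 (.u i, false) (.inl (0, false)) (.inl (0, true)) (by simp) rfl
    simp only [σ, σa, σd, σe, Bool.not_false] at h3 h4 h5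
    tauto
  have hsi : ∀ i, N (.s i, false) = .inr 1 ∨ N (.s i, false) = .inr 2 := by
    intro i
    have h3 := hN (.s i, false)
    have h4 := hw i
    rcases h : N (.s i, false) with c | c
    · rw [h] at h3
      simp only [σ, σa] at h3
      rw [h3] at h4
      simp at h4
    · fin_cases c
      · rw [h] at h3
        simp only [σ, σg] at h3
        rw [h3] at h4
        simp at h4
      · exact Or.inl rfl
      · exact Or.inr rfl
  have hW : N (.W, false) = .inr 0 := by
    by_contra hcon
    have h3 := hs (.W, false) (.inr 0) (Ne.symm hcon)
    have h4 := h2 (.W, false) (.inl (0, false)) (.inl (0, true)) (by simp) rfl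
    have h5 := h2 (.U, true) (.inr 1) (.inr 2) (by simp) rfl
    simp only [σ, σa, σd, σg, Bool.not_false, Bool.not_true] at h3 h4 h5
    tauto
  have hx : σ (N (.x, false)) (.x, false) = ((.n 0, false) : V m) := by
    have h3 := hN (.x, false)
    rcases h : N (.x, false) with c | c
    · rfl
    · fin_cases c
      · rfl
      · rw [h] at h3
        simp only [σ, σd] at h3
        rw [hW] at h3
        simp at h3
      · rw [h] at h3
        simp only [σ, σe] at h3
        rw [hW] at h3
        simp at h3
  -- pigeonhole
  let a : Option (Fin (m + 1)) → V m := fun o => o.elim (.x, false) (fun i => (.s i, false))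
  have ha : Function.Injective a := by
    rintro (_ | i) (_ | j) h <;> simp_all [a]
  have key : ∀ o, ∃ j, σ (N (a o)) (a o) = ((.n j, false) : V m) := by
    rintro (_ | i)
    · exact ⟨0, hx⟩
    · change ∃ j, σ (N (.s i, false)) (.s i, false) = ((.n j, false) : V m)
      rcases hsi i with h | h
      · rw [h]; exact ⟨i, rfl⟩
      · rw [h]; exact ⟨i + 1, rfl⟩
  choose j hj using key
  have hjinj : Function.Injective j := by
    intro o o' h
    apply ha
    have h3 : σ (N (a o)) (a o) = σ (N (a o')) (a o') := by rw [hj, hj, h]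
    have h4 : N (a o) = N (a o') := by rw [← hN (a o), ← hN (a o'), h3]
    rw [← (fam τ m).inv (N (a o)) (a o), ← (fam τ m).inv (N (a o')) (a o')]
    change σ (N (a o)) (σ (N (a o)) (a o)) = σ (N (a o')) (σ (N (a o')) (a o'))
    rw [h3, h4]
  have := Fintype.card_le_of_injective j hjinj
  simp at this

/-- The bipartition sign. -/
def sg : V m → ℝ
  | (.s _, b) => if b then -1 else 1
  | (.x, b) => if b then -1 else 1
  | (.n _, b) => if b then 1 else -1
  | (.w _, b) => if b then 1 else -1
  | (.u _, b) => if b then 1 else -1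
  | (.W, b) => if b then 1 else -1
  | (.U, b) => if b then 1 else -1

/-- Slack on the special colour of the first kind. -/
noncomputable def ya (δ : ℝ) : V m → ℝ
  | (.s _, _) => δ
  | (.w _, _) => δ
  | (.u _, _) => δ
  | (.n i, _) => if i = 0 then 1 - δ else 0
  | (.x, _) => 1 - δ
  | (.W, _) => -δ
  | (.U, _) => -δ

/-- Slack on the colour `γ`. -/
noncomputable def yg : V m → ℝ
  | (.W, _) => 1
  | (.U, _) => 1
  | _ => 0

/-- Slack on the colour `d`. -/
noncomputable def yd (δ : ℝ) : V m → ℝ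
  | (.s i, _) => (i : ℕ) * δ
  | (.n i, _) => (i : ℕ) * δ
  | (.w _, _) => 1
  | (.u _, _) => 1
  | (.x, _) => δ
  | (.W, _) => δ
  | (.U, _) => δ

/-- Slack on the colour `e`. -/
noncomputable def ye (δ : ℝ) : V m → ℝ
  | (.s i, _) => 1 - ((i : ℕ) + 1) * δ
  | (.n i, _) => if i = 0 then δ else 1 - (i : ℕ) * δ
  | (.w _, _) => -δ
  | (.u _, _) => -δ
  | (.x, _) => 0
  | (.W, _) => 0
  | (.U, _) => 0

/-- Orientation of the special colour of the first kind. -/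
def za : V m → ℝ
  | (.W, false) => -1
  | (.U, true) => -1
  | _ => 1

/-- Orientation of the colour `γ`. -/
def zg : V m → ℝ
  | (.W, false) => 1
  | (.U, true) => 1
  | _ => -1

/-- Orientation of the colour `d`. -/
def zd : V m → ℝ
  | (.w _, false) => 1
  | (.u _, true) => 1
  | _ => -1

/-- Orientation of the colour `e`. -/
def ze : V m → ℝ
  | (.w _, false) => -1
  | (.u _, true) => -1
  | _ => 1

/-- Slack. -/
noncomputable def y {τ : ℕ} (δ : ℝ) : K τ → V m → ℝ
  | .inl (j, b) => fun v => if j = 0 ∧ b = true then ya δ v else 0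
  | .inr 0 => yg
  | .inr 1 => yd δ
  | .inr 2 => ye δ

/-- Orientation. -/
noncomputable def z {τ : ℕ} : K τ → V m → ℝ
  | .inl (j, true) => fun v => if j = 0 then za v else 1
  | .inl (_, false) => fun _ => -1
  | .inr 0 => zg
  | .inr 1 => zd
  | .inr 2 => ze

/-- The flow (before scaling). -/
noncomputable def F {τ : ℕ} (ρ δ : ℝ) (c : K τ) (v : V m) : ℝ :=
  sg v * (z c v * (1 + ρ) + ρ * (1 - y δ c v))

lemma sum_y {τ : ℕ} (δ : ℝ) (v : V m) : ∑ c : K τ, y δ c v = 1 := by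
  rw [Fintype.sum_sum_type, Fintype.sum_prod_type, Fin.sum_univ_succ]
  simp only [Fin.sum_univ_three, y, Fintype.sum_bool]
  obtain ⟨v, b⟩ := v
  cases v <;> simp [ya, yg, yd, ye, Fin.succ_ne_zero] <;> (try split_ifs) <;> (try simp_all) <;> (try ring)

lemma sum_z {τ : ℕ} (v : V m) : ∑ c : K τ, z c v = -1 := by
  rw [Fintype.sum_sum_type, Fintype.sum_prod_type, Fin.sum_univ_succ]
  simp only [Fin.sum_univ_three, z, Fintype.sum_bool]
  obtain ⟨v, b⟩ := v
  cases v <;> cases b <;> simp [za, zg, zd, ze, Fin.succ_ne_zero]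

lemma sum_F {τ : ℕ} (ρ δ : ℝ) (hρ : ρ * (2 * τ + 3) = 1) (v : V m) :
    ∑ c : K τ, F ρ δ c v = 0 := by
  simp only [F]
  rw [← Finset.mul_sum, Finset.sum_add_distrib, ← Finset.sum_mul, ← Finset.mul_sum,
    Finset.sum_sub_distrib, sum_z, sum_y]
  have h : ∑ _c : K τ, (1 : ℝ) = 2 * τ + 5 := by
    simp; ring
  rw [h]
  have : -1 * (1 + ρ) + ρ * (2 * τ + 5 - 1) = 0 := by linarith
  rw [this, mul_zero]

lemma ye_succ (δ : ℝ) (hδ : δ * (m + 2) = 1) (i : Fin (m + 1)) (b : Bool) :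
    ye δ (.n (i + 1), b) = ye δ (.s i, b) := by
  simp only [ye]
  by_cases h : i = Fin.last m
  · subst h
    simp only [Fin.last_add_one, if_true, Fin.val_last]
    linarith
  · have h1 : ((i + 1 : Fin (m + 1)) : ℕ) = i + 1 := Fin.val_add_one_of_lt (Fin.lt_last_iff_ne_last.2 h)
    have h2 : i + 1 ≠ 0 := by
      intro h3
      rw [h3] at h1
      simp at h1
    rw [if_neg h2, h1]
    push_cast
    ring

lemma ye_pred (δ : ℝ) (hδ : δ * (m + 2) = 1) (i : Fin (m + 1)) (b : Bool) :
    ye δ (.s (i - 1), b) = ye δ (.n i, b) := by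
  rw [← ye_succ δ hδ, sub_add_cancel]

lemma F_anti {τ : ℕ} (ρ δ : ℝ) (hδ : δ * (m + 2) = 1) (c : K τ) (v : V m) :
    F ρ δ c (σ c v) = - F ρ δ c v := by
  obtain ⟨v, b⟩ := v
  rcases c with ⟨j, b'⟩ | c
  · cases b' <;> cases v <;> cases b <;> simp [F, σ, σa, y, z, sg, ya, za] <;>
      split_ifs <;> simp_all
  · fin_cases c
    · cases v <;> cases b <;> simp [F, σ, σg, y, z, sg, yg, zg] <;>
        (try split_ifs) <;> simp_all
    · cases v <;> cases b <;> simp [F, σ, σd, y, z, sg, yd, zd]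
    · cases v with
      | s i =>
        have := ye_succ δ hδ i b
        cases b <;> simp [F, σ, σe, y, z, sg, ze, this]
      | n i =>
        have := ye_pred δ hδ i b
        cases b <;> simp [F, σ, σe, y, z, sg, ze, this]
      | _ => cases b <;> simp [F, σ, σe, y, z, sg, ye, ze]

lemma y_bound {τ : ℕ} (δ : ℝ) (h0 : 0 ≤ δ) (hδ : δ * (m + 2) = 1) (c : K τ) (v : V m) :
    -δ ≤ y δ c v ∧ y δ c v ≤ 1 := by
  have hm : (0 : ℝ) ≤ m := Nat.cast_nonneg m
  have h1 : δ ≤ 1 := by nlinarith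
  have hi : ∀ i : Fin (m + 1), ((i : ℕ) : ℝ) * δ + δ ≤ 1 := by
    intro i
    have h2 : ((i : ℕ) : ℝ) ≤ m := by exact_mod_cast Nat.lt_succ_iff.1 i.2
    nlinarith
  have hi0 : ∀ i : Fin (m + 1), 0 ≤ ((i : ℕ) : ℝ) * δ := fun i => by positivity
  obtain ⟨v, b⟩ := v
  rcases c with ⟨j, b'⟩ | c
  · simp only [y]
    split_ifs
    · cases v with
      | n i => simp only [ya]; split_ifs <;> constructor <;> linarith
      | _ => simp only [ya]; constructor <;> linarith
    · constructor <;> linarith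
  · fin_cases c
    · cases v <;> simp [y, yg] <;> linarith
    · cases v with
      | s i => have := hi i; have := hi0 i; simp only [y, yd]; constructor <;> linarith
      | n i => have := hi i; have := hi0 i; simp only [y, yd]; constructor <;> linarith
      | _ => simp only [y, yd]; constructor <;> linarith
    · cases v with
      | s i => have := hi i; have := hi0 i; simp only [y, ye]; constructor <;> linarith
      | n i =>
        have := hi i; have := hi0 i
        simp only [y, ye]; split_ifs <;> constructor <;> linarith
      | _ => simp only [y, ye]; constructor <;> linarith

lemma z_val {τ : ℕ} (c : K τ) (v : V m) : z c v = 1 ∨ z c v = -1 := by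
  obtain ⟨v, b⟩ := v
  rcases c with ⟨j, b'⟩ | c
  · cases b' <;> cases v <;> cases b <;> simp [z, za]
    all_goals by_cases hj : j = 0 <;> simp [hj]
  · fin_cases c <;> cases v <;> cases b <;> simp [z, zg, zd, ze]

lemma sg_val (v : V m) : sg v = 1 ∨ sg v = -1 := by
  obtain ⟨v, b⟩ := v
  cases v <;> cases b <;> simp [sg]

lemma F_bound {τ : ℕ} (ρ δ : ℝ) (hρ : 0 ≤ ρ) (hρ1 : ρ ≤ 1) (h0 : 0 ≤ δ) (hδ : δ * (m + 2) = 1)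
    (c : K τ) (v : V m) : 1 - ρ * δ ≤ |F ρ δ c v| ∧ |F ρ δ c v| ≤ 1 + 2 * ρ + ρ * δ := by
  obtain ⟨h1, h2⟩ := y_bound δ h0 hδ c v
  have hm : (0 : ℝ) ≤ m := Nat.cast_nonneg m
  have h3 : δ ≤ 1 := by nlinarith
  have h4 : ρ * y δ c v ≤ ρ * 1 := mul_le_mul_of_nonneg_left h2 hρ
  have h5 : ρ * (-δ) ≤ ρ * y δ c v := mul_le_mul_of_nonneg_left h1 hρ
  have h6 : 0 ≤ ρ * δ := mul_nonneg hρ h0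
  have h7 : ρ * δ ≤ 1 := by nlinarith
  have hs : |sg v| = 1 := by rcases sg_val v with h | h <;> simp [h]
  unfold F
  rw [abs_mul, hs, one_mul]
  rcases z_val c v with h | h
  · rw [h, abs_of_nonneg (by linarith)]
    constructor <;> linarith
  · rw [h, abs_of_nonpos (by linarith)]
    constructor <;> linarith

lemma fam_flow (τ m : ℕ) (ρ δ : ℝ) (hρ : ρ * (2 * τ + 3) = 1) (hδ : δ * (m + 2) = 1) :
    (fam τ m).graph.HasNZFlow (2 + 2 * ρ + 4 * δ) := by
  have hm : (0 : ℝ) ≤ m := Nat.cast_nonneg m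
  have hτ : (0 : ℝ) ≤ τ := Nat.cast_nonneg τ
  have hρ0 : 0 < ρ := by
    by_contra h
    push Not at h
    nlinarith
  have hδ0 : 0 < δ := by
    by_contra h
    push Not at h
    nlinarith
  have hρ1 : ρ ≤ 1 / 3 := by nlinarith
  have hδ1 : δ ≤ 1 / 2 := by nlinarith
  have h6 : 0 ≤ ρ * δ := by positivity
  have h7 : ρ * δ ≤ 1 / 3 * δ := mul_le_mul_of_nonneg_right hρ1 hδ0.le
  have hL : 0 < 1 - ρ * δ := by linarith
  refine (fam τ m).hasFlow (fun c v => F ρ δ c v / (1 - ρ * δ)) _ ?_ ?_ ?_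
  · intro c v
    change V m at v
    change F ρ δ c (σ c v) / _ = _
    rw [F_anti ρ δ hδ, neg_div]
  · intro c v
    obtain ⟨h1, h2⟩ := F_bound ρ δ hρ0.le (by linarith) hδ0.le hδ c v
    rw [abs_div, abs_of_pos hL, le_div_iff₀ hL, div_le_iff₀ hL]
    refine ⟨by linarith, h2.trans ?_⟩
    have h8 : ρ * (ρ * δ) ≤ 1 / 3 * (1 / 3 * δ) := by nlinarith
    have h9 : δ * (ρ * δ) ≤ 1 / 2 * (1 / 3 * δ) := by nlinarith
    nlinarith
  · intro v
    change V m at v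
    rw [← Finset.sum_div, sum_F ρ δ hρ, zero_div]

end Constr

/-- For every integer `t ≥ 2`,
`Φ⁽¹⁾(2t+1) = inf{φ_c(G) : G ∈ 𝒢_{2t+1}} = 2 + 2/(2t-1)`, where `𝒢_{2t+1}` is the
class of `(2t+1)`-regular class 1 multigraphs having no perfect matching whose
removal leaves a bipartite graph. -/
theorem statement_1 (t : ℕ) (ht : 2 ≤ t) :
    sInf {x : EReal | ∃ G : Multigraph,
        G.IsRegular (2 * t + 1) ∧ G.IsClass1 ∧
        (¬ ∃ M : Set G.E, G.IsPerfectMatching M ∧ (G.deleteEdges M).IsBipartite) ∧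
        G.flowNumber = x}
      = ((2 + 2 / (2 * (t : ℝ) - 1) : ℝ) : EReal) := by
  apply le_antisymm
  · obtain ⟨τ, rfl⟩ : ∃ τ, t = τ + 2 := ⟨t - 2, by omega⟩
    have hτ : (0 : ℝ) ≤ τ := Nat.cast_nonneg τ
    apply EReal.le_of_forall_lt_iff_le.1
    intro b hb
    rw [EReal.coe_lt_coe_iff] at hb
    set ρ : ℝ := 1 / (2 * τ + 3) with hρ
    have hρ1 : ρ * (2 * τ + 3) = 1 := by rw [hρ]; field_simp
    have hρ2 : 2 + 2 / (2 * ((τ + 2 : ℕ) : ℝ) - 1) = 2 + 2 * ρ := by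
      rw [hρ]
      have h1 : 2 * ((τ + 2 : ℕ) : ℝ) - 1 = 2 * τ + 3 := by push_cast; ring
      rw [h1]
      ring
    rw [hρ2] at hb
    obtain ⟨m, hm⟩ := exists_nat_one_div_lt (show 0 < (b - (2 + 2 * ρ)) / 4 by linarith)
    have hm0 : (0 : ℝ) ≤ m := Nat.cast_nonneg m
    have hδ : 1 / ((m : ℝ) + 2) ≤ 1 / ((m : ℝ) + 1) :=
      one_div_le_one_div_of_le (by linarith) (by linarith)
    have hδ1 : (1 / ((m : ℝ) + 2)) * (m + 2) = 1 := by field_simp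
    have hδ0 : 0 ≤ 1 / ((m : ℝ) + 2) := by positivity
    have hρ0 : 0 ≤ ρ := by positivity
    have hcard : Nat.card (Constr.K τ) = 2 * (τ + 2) + 1 := by
      simp [Constr.K]; ring
    have hne : Nonempty (Constr.fam τ m).V := ⟨((.x, false) : Constr.V m)⟩
    refine le_trans (sInf_le ⟨(Constr.fam τ m).graph, ?_, ?_, ?_, rfl⟩) ?_
    · rw [← hcard]; exact (Constr.fam τ m).regular
    · exact (Constr.fam τ m).class1
    · exact (Constr.fam τ m).noPM (Constr.fam_noPM τ m)
    · refine le_trans (sInf_le ⟨_, rfl, ?_, Constr.fam_flow τ m ρ _ hρ1 hδ1⟩) ?_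
      · linarith
      · rw [EReal.coe_le_coe_iff]
        linarith
  · apply le_sInf
    rintro x ⟨G, h1, h2, h3, rfl⟩
    exact Multigraph.aux_lower ht h1 h2 h3
end

section
/- For every integer t ≥ 1 and every real ε > 0, there exists a bridgeless (2t+1)-regular class 2 multigraph G with φ_c(G) < 2 + 2/(2t−1) + ε. -/
namespace FlowRing

open Multigraph

/-- A graph with a nowhere-zero flow has no bridge: sum Kirchhoff's law over one side. -/
theorem bridgeless_of_flow (G : Multigraph) {r : ℝ} (h : G.HasNZFlow r) : G.Bridgeless := by
  classical
  obtain ⟨f, hf, hk⟩ := h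
  intro e he
  haveI := Fintype.ofFinite G.V
  haveI := Fintype.ofFinite G.E
  set X : G.V → Prop := fun u => (G.deleteEdges {e}).Reach (G.tail e) u with hX
  have hother : ∀ e', e' ≠ e → (X (G.tail e') ↔ X (G.head e')) := by
    intro e' hne
    constructor
    · intro h
      exact Relation.ReflTransGen.tail h ⟨⟨e', by simpa using hne⟩, Or.inl rfl⟩
    · intro h
      exact Relation.ReflTransGen.tail h ⟨⟨e', by simpa using hne⟩, Or.inr rfl⟩
  have ht : X (G.tail e) := Relation.ReflTransGen.refl
  have hh : ¬ X (G.head e) := he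
  have hk' : ∀ v, ∑ e', (if G.tail e' = v then f e' else 0)
      = ∑ e', (if G.head e' = v then f e' else 0) := by
    intro v
    have := hk v
    rw [finsum_mem_def, finsum_mem_def, finsum_eq_sum_of_fintype, finsum_eq_sum_of_fintype] at this
    simpa [Set.indicator_apply] using this
  have h1 : ∑ v, (if X v then ∑ e', (if G.tail e' = v then f e' else 0) else 0)
      = ∑ e', (if X (G.tail e') then f e' else 0) := by
    have : ∀ v, (if X v then ∑ e', (if G.tail e' = v then f e' else 0) else 0)
        = ∑ e', (if G.tail e' = v then (if X (G.tail e') then f e' else 0) else 0) := by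
      intro v
      by_cases hv : X v
      · rw [if_pos hv]
        refine Finset.sum_congr rfl fun e' _ => ?_
        split_ifs with h1 h2 <;> simp_all
      · rw [if_neg hv]
        symm
        refine Finset.sum_eq_zero fun e' _ => ?_
        split_ifs with h1 h2 <;> simp_all
    rw [Finset.sum_congr rfl fun v _ => this v, Finset.sum_comm]
    simp
  have h2 : ∑ v, (if X v then ∑ e', (if G.head e' = v then f e' else 0) else 0)
      = ∑ e', (if X (G.head e') then f e' else 0) := by
    have : ∀ v, (if X v then ∑ e', (if G.head e' = v then f e' else 0) else 0)
        = ∑ e', (if G.head e' = v then (if X (G.head e') then f e' else 0) else 0) := by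
      intro v
      by_cases hv : X v
      · rw [if_pos hv]
        refine Finset.sum_congr rfl fun e' _ => ?_
        split_ifs with h1 h2 <;> simp_all
      · rw [if_neg hv]
        symm
        refine Finset.sum_eq_zero fun e' _ => ?_
        split_ifs with h1 h2 <;> simp_all
    rw [Finset.sum_congr rfl fun v _ => this v, Finset.sum_comm]
    simp
  have h3 : ∑ e', (if X (G.tail e') then f e' else 0)
      = ∑ e', (if X (G.head e') then f e' else 0) := by
    rw [← h1, ← h2]
    refine Finset.sum_congr rfl fun v _ => ?_
    rw [hk' v]
  have h4 : ∑ e', ((if X (G.tail e') then f e' else 0) - (if X (G.head e') then f e' else 0))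
      = f e := by
    rw [Finset.sum_eq_single e]
    · simp [ht, hh]
    · intro e' _ hne
      simp [hother e' hne]
    · simp
  rw [Finset.sum_sub_distrib, h3, sub_self] at h4
  have := (hf e).1
  rw [← h4] at this
  norm_num at this

/-- Data of a 2-factor (`nxt`, `prv`) on `S × Bool`, where `s : S` indexes the rung joining
`(s, false)` and `(s, true)`. -/
structure Rungs (S : Type) where
  nxt : S × Bool → S × Bool
  prv : S × Bool → S × Bool
  prv_nxt : ∀ v, prv (nxt v) = v
  nxt_prv : ∀ v, nxt (prv v) = v
  ne : ∀ v, nxt v ≠ v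

variable {S : Type}

theorem Rungs.nxt_eq_iff (R : Rungs S) (u v : S × Bool) : R.nxt u = v ↔ u = R.prv v :=
  ⟨fun h => by rw [← h, R.prv_nxt], fun h => by rw [h, R.nxt_prv]⟩

theorem Rungs.prv_ne (R : Rungs S) (v : S × Bool) : R.prv v ≠ v := by
  intro h
  have := R.ne (R.prv v)
  rw [R.nxt_prv] at this
  exact this h.symm

/-- The 2-factor together with `2 T + 1` parallel copies of each rung. -/
def graph (R : Rungs S) [Finite S] (T : ℕ) : Multigraph where
  V := S × Bool
  E := (S × Bool) ⊕ (S × (Fin (T + 1) ⊕ Fin T))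
  vFinite := by infer_instance
  eFinite := by infer_instance
  ends := Sum.elim (fun v => (v, R.nxt v)) (fun p => ((p.1, false), (p.1, true)))
  no_loop := by
    rintro (v | p)
    · exact (R.ne v).symm
    · simp

section
variable (R : Rungs S) [Finite S] (T : ℕ)

theorem inc_inl (v u : S × Bool) :
    (graph R T).Inc v (Sum.inl u) ↔ (u = v ∨ u = R.prv v) := by
  rw [← R.nxt_eq_iff]; rfl

theorem inc_inr (v : S × Bool) (p : S × (Fin (T + 1) ⊕ Fin T)) :
    (graph R T).Inc v (Sum.inr p) ↔ p.1 = v.1 := by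
  obtain ⟨s, b⟩ := v
  show ((p.1, false) = (s, b) ∨ (p.1, true) = (s, b)) ↔ _
  cases b <;> simp

/-- The edges at a vertex. -/
noncomputable def starMap (v : S × Bool) :
    Bool ⊕ (Fin (T + 1) ⊕ Fin T) → {e : (graph R T).E // (graph R T).Inc v e} :=
  Sum.elim (fun b => ⟨Sum.inl (if b then v else R.prv v), by
    rw [inc_inl]; cases b <;> simp⟩) (fun j => ⟨Sum.inr (v.1, j), by rw [inc_inr]⟩)

theorem starMap_bij (v : S × Bool) : Function.Bijective (starMap R T v) := by
  have hp := R.prv_ne v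
  constructor
  · rintro (b | j) (b' | j') h
    · have h := Subtype.ext_iff.1 h
      have h : (if b then v else R.prv v) = (if b' then v else R.prv v) := Sum.inl_injective h
      cases b <;> cases b' <;> simp_all [eq_comm]
    · have h := Subtype.ext_iff.1 h
      cases h
    · have h := Subtype.ext_iff.1 h
      cases h
    · have h := Subtype.ext_iff.1 h
      have h : (v.1, j) = (v.1, j') := Sum.inr_injective h
      simp_all
  · rintro ⟨e | ⟨s, j⟩, h⟩
    · rcases (inc_inl R T v e).1 h with h' | h'
      · exact ⟨Sum.inl true, Subtype.ext (by subst h'; rfl)⟩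
      · exact ⟨Sum.inl false, Subtype.ext (by subst h'; rfl)⟩
    · have h' : s = v.1 := (inc_inr R T v (s, j)).1 h
      exact ⟨Sum.inr j, Subtype.ext (by subst h'; rfl)⟩

theorem regular : (graph R T).IsRegular (2 * (T + 1) + 1) := by
  intro v
  unfold Multigraph.degree
  rw [← Nat.card_congr (Equiv.ofBijective _ (starMap_bij R T v))]
  simp
  omega

/-- In a coloring with `2T+3` colors the two 2-factor edges at both ends of a rung have the same
pair of colors. -/
theorem pair_eq (c : (graph R T).E → Fin (2 * (T + 1) + 1))
    (hc : (graph R T).IsProperEdgeColoring c) (v : S × Bool) (x : Fin (2 * (T + 1) + 1)) :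
    (x = c (Sum.inl v) ∨ x = c (Sum.inl (R.prv v))) ↔
      ∀ j, x ≠ c (Sum.inr (v.1, j)) := by
  have hinj : Function.Injective (fun z => c (starMap R T v z).1) := by
    intro z z' h
    by_contra hne
    exact hc _ _ ⟨fun h' => hne ((starMap_bij R T v).1 (Subtype.ext h')),
      v, (starMap R T v z).2, (starMap R T v z').2⟩ h
  have hbij : Function.Bijective (fun z => c (starMap R T v z).1) := by
    rw [Fintype.bijective_iff_injective_and_card]
    refine ⟨hinj, ?_⟩
    simp
    omega
  constructor
  · rintro h j hj
    rcases h with h | h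
    · have : (Sum.inl true : Bool ⊕ (Fin (T + 1) ⊕ Fin T)) = Sum.inr j :=
        hinj (h.symm.trans hj)
      cases this
    · have : (Sum.inl false : Bool ⊕ (Fin (T + 1) ⊕ Fin T)) = Sum.inr j :=
        hinj (h.symm.trans hj)
      cases this
  · intro h
    obtain ⟨z, hz⟩ := hbij.2 x
    rcases z with b | j
    · cases b
      · exact Or.inr hz.symm
      · exact Or.inl hz.symm
    · exact absurd hz.symm (h j)

theorem col_ne (c : (graph R T).E → Fin (2 * (T + 1) + 1))
    (hc : (graph R T).IsProperEdgeColoring c) (v : S × Bool) :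
    c (Sum.inl (R.prv v)) ≠ c (Sum.inl v) := by
  apply hc
  refine ⟨fun h => R.prv_ne v (Sum.inl_injective h), v, ?_, ?_⟩
  · rw [inc_inl]; simp
  · rw [inc_inl]; simp

theorem class2_of [Nonempty S]
    (h : ∀ C : S × Bool → Fin (2 * (T + 1) + 1), (∀ v, C (R.prv v) ≠ C v) →
      (∀ s x, (x = C (s, false) ∨ x = C (R.prv (s, false))) ↔
        (x = C (s, true) ∨ x = C (R.prv (s, true)))) → False) :
    (graph R T).IsClass2 := by
  intro h1
  unfold Multigraph.IsClass1 at h1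
  have hd : (graph R T).maxDegree = 2 * (T + 1) + 1 := by
    unfold Multigraph.maxDegree
    have : Set.range (graph R T).degree = {2 * (T + 1) + 1} := by
      ext k
      constructor
      · rintro ⟨v, rfl⟩
        exact regular R T v
      · rintro rfl
        exact ⟨(Classical.arbitrary S, true), regular R T _⟩
    rw [this, csSup_singleton]
  rw [hd] at h1
  have hmem : (graph R T).chromaticIndex ∈
      {k | ∃ c : (graph R T).E → Fin k, (graph R T).IsProperEdgeColoring c} := by
    apply Nat.sInf_mem
    by_contra hne
    rw [Set.not_nonempty_iff_eq_empty] at hne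
    unfold Multigraph.chromaticIndex at h1
    rw [hne, Nat.sInf_empty] at h1
    omega
  rw [h1] at hmem
  obtain ⟨c, hc⟩ := hmem
  refine h (fun v => c (Sum.inl v)) (col_ne R T c hc) fun s x => ?_
  rw [pair_eq R T c hc (s, false) x, pair_eq R T c hc (s, true) x]

/-- value on the copies of a rung carrying total flow `g` -/
noncomputable def copyVal (g : ℝ) : Fin (T + 1) ⊕ Fin T → ℝ :=
  Sum.elim (fun _ => SignType.sign g * (2 * T + 1 + (|g| - 1) / (2 * T + 1)))
    (fun _ => - (SignType.sign g * (2 * T + 3 - (|g| - 1) / (2 * T + 1))))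

theorem copyVal_sum (g : ℝ) : ∑ j, copyVal T g j = g := by
  have h : (2 * (T : ℝ) + 1) ≠ 0 := by positivity
  simp only [copyVal, Fintype.sum_sum_type, Sum.elim_inl, Sum.elim_inr, Finset.sum_const,
    Finset.card_univ, Fintype.card_fin, nsmul_eq_mul]
  have hs : (SignType.sign g : ℝ) * |g| = g := by rw [sign_mul_abs]
  have : (SignType.sign g : ℝ) * (1 + (2 * T + 1) * ((|g| - 1) / (2 * T + 1))) = g := by
    rw [mul_div_cancel₀ _ h]
    linear_combination hs
  push_cast
  linear_combination this

theorem copyVal_bound {g δ : ℝ} (hδ : δ ≤ 1) (h1 : 1 ≤ |g|) (h2 : |g| ≤ 1 + δ)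
    (j : Fin (T + 1) ⊕ Fin T) :
    2 * T + 1 ≤ |copyVal T g j| ∧ |copyVal T g j| ≤ 2 * T + 3 + δ := by
  have hT : (0 : ℝ) ≤ T := Nat.cast_nonneg T
  have hg : g ≠ 0 := by rintro rfl; norm_num at h1
  have hsg : |(SignType.sign g : ℝ)| = 1 := by
    rcases lt_or_gt_of_ne hg with h | h <;> simp [h]
  have hs0 : 0 ≤ (|g| - 1) / (2 * T + 1) := by
    apply div_nonneg <;> linarith
  have hs1 : (|g| - 1) / (2 * T + 1) ≤ δ := by
    rw [div_le_iff₀ (by positivity)]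
    nlinarith
  rcases j with j | j
  · simp only [copyVal, Sum.elim_inl, abs_mul, hsg, one_mul]
    rw [abs_of_nonneg (by positivity)]
    constructor <;> linarith
  · simp only [copyVal, Sum.elim_inr, abs_neg, abs_mul, hsg, one_mul]
    rw [abs_of_nonneg (by linarith)]
    constructor <;> linarith

theorem sum_edges [Fintype S] (f : (graph R T).E → ℝ) :
    ∑ᶠ e, f e = ∑ u : S × Bool, f (Sum.inl u) +
      ∑ p : S × (Fin (T + 1) ⊕ Fin T), f (Sum.inr p) := by
  have h : ∀ f' : (S × Bool) ⊕ (S × (Fin (T + 1) ⊕ Fin T)) → ℝ,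
      ∑ᶠ e, f' e = ∑ u : S × Bool, f' (Sum.inl u) +
      ∑ p : S × (Fin (T + 1) ⊕ Fin T), f' (Sum.inr p) := by
    intro f'
    rw [finsum_eq_sum_of_fintype, Fintype.sum_sum_type]
  exact h f

theorem flow_of (x : S × Bool → ℝ) (g : S → ℝ) (δ : ℝ) (hδ : δ ≤ 1)
    (hx : ∀ v, 1 ≤ x v ∧ x v ≤ 3 + δ) (hg : ∀ s, 1 ≤ |g s| ∧ |g s| ≤ 1 + δ)
    (hf : ∀ s, x (R.prv (s, false)) = x (s, false) + g s)
    (ht : ∀ s, x (R.prv (s, true)) + g s = x (s, true)) :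
    (graph R T).HasNZFlow (2 + (2 + δ) / (2 * T + 1)) := by
  classical
  haveI := Fintype.ofFinite S
  have hT : (0 : ℝ) ≤ T := Nat.cast_nonneg T
  have hpos : (0 : ℝ) < 2 * T + 1 := by positivity
  let F : (graph R T).E → ℝ :=
    Sum.elim (fun v => x v + 2 * T) (fun p => copyVal T (g p.1) p.2)
  have hF : ∀ e, 2 * T + 1 ≤ |F e| ∧ |F e| ≤ 2 * T + 3 + δ := by
    rintro (v | p)
    · have := hx v
      show _ ≤ |x v + 2 * T| ∧ |x v + 2 * T| ≤ _
      rw [abs_of_nonneg (by linarith)]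
      constructor <;> linarith
    · exact copyVal_bound T hδ (hg p.1).1 (hg p.1).2 p.2
  refine ⟨fun e => (2 * T + 1 : ℝ)⁻¹ * F e, ?_, ?_⟩
  · intro e
    have := hF e
    rw [abs_mul, abs_of_pos (inv_pos.2 hpos), inv_mul_eq_div, le_div_iff₀ hpos,
      div_le_iff₀ hpos]
    refine ⟨by linarith, ?_⟩
    have h2 : (2 + (2 + δ) / (2 * T + 1) - 1) * (2 * (T : ℝ) + 1) = 2 * T + 3 + δ := by
      field_simp
      ring
    rw [h2]; exact this.2
  · intro v'
    rw [finsum_mem_def, finsum_mem_def]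
    simp only [Set.indicator_apply]
    rw [sum_edges, sum_edges]
    revert v'
    intro (v : S × Bool)
    have e1 : ∀ w : S × Bool, ∑ u : S × Bool, (if u = w then (2 * T + 1 : ℝ)⁻¹ * (x u + 2 * T)
        else 0) = (2 * T + 1 : ℝ)⁻¹ * (x w + 2 * T) := by
      intro w
      simp
    have e2 : ∀ b : Bool, ∑ p : S × (Fin (T + 1) ⊕ Fin T),
        (if (p.1, b) = v then (2 * T + 1 : ℝ)⁻¹ * copyVal T (g p.1) p.2 else 0)
          = (2 * T + 1 : ℝ)⁻¹ * (if v.2 = b then g v.1 else 0) := by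
      intro b
      rw [Fintype.sum_prod_type]
      obtain ⟨s, b'⟩ := v
      by_cases hb : b' = b
      · subst hb
        simp only [Prod.mk.injEq, and_true, if_true]
        rw [Finset.sum_eq_single s]
        · simp only [if_true]
          rw [← Finset.mul_sum, copyVal_sum]
        · intro s' _ hs'
          simp [hs']
        · simp
      · simp [hb, Ne.symm hb, eq_comm]
    have main : (∑ u : S × Bool, (if u = v then (2 * T + 1 : ℝ)⁻¹ * (x u + 2 * T) else 0)) +
        (∑ p : S × (Fin (T + 1) ⊕ Fin T),
        (if (p.1, false) = v then (2 * T + 1 : ℝ)⁻¹ * copyVal T (g p.1) p.2 else 0)) =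
        (∑ u : S × Bool, (if R.nxt u = v then (2 * T + 1 : ℝ)⁻¹ * (x u + 2 * T) else 0)) +
        (∑ p : S × (Fin (T + 1) ⊕ Fin T),
        (if (p.1, true) = v then (2 * T + 1 : ℝ)⁻¹ * copyVal T (g p.1) p.2 else 0)) := by
      simp only [R.nxt_eq_iff]
      rw [e1, e1, e2, e2, ← mul_add, ← mul_add]
      congr 1
      obtain ⟨s, b⟩ := v
      cases b
      · have := hf s
        simp only [if_true, Bool.false_eq_true, if_false]
        linarith
      · have := ht s
        simp only [if_true, Bool.true_eq_false, if_false]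
        linarith
    refine Eq.trans (congrArg₂ (· + ·) (Finset.sum_congr rfl fun u _ => ?_)
      (Finset.sum_congr rfl fun p _ => ?_)) (main.trans (Eq.symm
      (congrArg₂ (· + ·) (Finset.sum_congr rfl fun u _ => ?_)
      (Finset.sum_congr rfl fun p _ => ?_))))
    all_goals exact if_congr Iff.rfl rfl rfl

end

/-! ### The concrete family: three strands, `n` pairs of Petersen pieces and one extra rung -/

/-- Rung labels: `none` is the extra rung. -/
abbrev Lab (n : ℕ) : Type := Option (ZMod n × Bool × Fin 4)

/-- successor in the 2-factor -/
def nx (n : ℕ) : Lab n × Bool → Lab n × Bool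
  | (some (i, x, 0), false) => (some (i, x, 1), false)
  | (some (i, x, 1), false) => (some (i, x, 2), false)
  | (some (i, x, 2), false) => (some (i, x, 3), false)
  | (some (i, false, 3), false) => (some (i, true, 0), false)
  | (some (i, true, 3), false) => (some (i + 1, false, 0), false)
  | (some (i, x, 2), true) => (some (i, x, 0), true)
  | (some (i, x, 0), true) => (some (i, x, 3), true)
  | (some (i, x, 3), true) => (some (i, x, 1), true)
  | (some (i, x, 1), true) => if i + 1 = 0 then (none, x) else (some (i + 1, x, 2), true)
  | (none, x) => (some (0, x, 2), true)

/-- predecessor in the 2-factor -/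
def pv (n : ℕ) : Lab n × Bool → Lab n × Bool
  | (some (i, x, 1), false) => (some (i, x, 0), false)
  | (some (i, x, 2), false) => (some (i, x, 1), false)
  | (some (i, x, 3), false) => (some (i, x, 2), false)
  | (some (i, true, 0), false) => (some (i, false, 3), false)
  | (some (i, false, 0), false) => (some (i - 1, true, 3), false)
  | (some (i, x, 0), true) => (some (i, x, 2), true)
  | (some (i, x, 3), true) => (some (i, x, 0), true)
  | (some (i, x, 1), true) => (some (i, x, 3), true)
  | (some (i, x, 2), true) => if i = 0 then (none, x) else (some (i - 1, x, 1), true)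
  | (none, x) => (some (-1, x, 1), true)

theorem pv_nx (n : ℕ) : ∀ v, pv n (nx n v) = v := by
  rintro ⟨_ | ⟨i, x, k⟩, b⟩
  · simp [nx, pv]
  · fin_cases k <;> cases b <;> cases x <;> simp [nx, pv] <;>
      (split_ifs with h <;> simp [pv, h]; try exact (eq_neg_of_add_eq_zero_left h).symm)

theorem nx_pv (n : ℕ) : ∀ v, nx n (pv n v) = v := by
  rintro ⟨_ | ⟨i, x, k⟩, b⟩
  · simp [nx, pv]
  · fin_cases k <;> cases b <;> cases x <;> simp [nx, pv] <;>
      (split_ifs with h <;> simp [nx, h])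

theorem nx_ne (n : ℕ) : ∀ v, nx n v ≠ v := by
  rintro ⟨_ | ⟨i, x, k⟩, b⟩
  · simp [nx]
  · fin_cases k <;> cases b <;> cases x <;> simp [nx] <;>
      (split_ifs with h <;> simp)

/-- the concrete 2-factor with rungs -/
def ring (n : ℕ) : Rungs (Lab n) := ⟨nx n, pv n, pv_nx n, nx_pv n, nx_ne n⟩

/-- A Petersen piece transmits the colors along its strands. -/
theorem piece {K : Type} (p0 p1 p2 p3 p4 q0 q1 q2 q3 q4 : K)
    (hp1 : p0 ≠ p1) (hp2 : p1 ≠ p2) (hp3 : p2 ≠ p3) (hp4 : p3 ≠ p4)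
    (hq1 : q0 ≠ q1) (hq2 : q1 ≠ q2) (hq3 : q2 ≠ q3) (hq4 : q3 ≠ q4)
    (h1 : ∀ x, (x = p1 ∨ x = p0) ↔ (x = q2 ∨ x = q1))
    (h2 : ∀ x, (x = p2 ∨ x = p1) ↔ (x = q4 ∨ x = q3))
    (h3 : ∀ x, (x = p3 ∨ x = p2) ↔ (x = q1 ∨ x = q0))
    (h4 : ∀ x, (x = p4 ∨ x = p3) ↔ (x = q3 ∨ x = q2)) : q0 = q4 := by
  have a1 := (h1 p1).1 (Or.inl rfl)
  have a2 := (h1 p0).1 (Or.inr rfl)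
  have b1 := (h2 p2).1 (Or.inl rfl)
  have b2 := (h2 p1).1 (Or.inr rfl)
  have c1 := (h3 p3).1 (Or.inl rfl)
  have c2 := (h3 p2).1 (Or.inr rfl)
  have d1 := (h4 p4).1 (Or.inl rfl)
  have d2 := (h4 p3).1 (Or.inr rfl)
  clear h1 h2 h3 h4
  grind

theorem ring_class2 (n : ℕ) [NeZero n] (T : ℕ) : (graph (ring n) T).IsClass2 := by
  apply class2_of
  intro C hne hpair
  have step : ∀ i : ZMod n, C (pv n (some (i, false, 2), true)) = C (some (i, false, 1), true) := by
    intro i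
    exact piece (C (pv n (some (i, false, 0), false))) (C (some (i, false, 0), false))
      (C (some (i, false, 1), false)) (C (some (i, false, 2), false))
      (C (some (i, false, 3), false))
      (C (pv n (some (i, false, 2), true))) (C (some (i, false, 2), true))
      (C (some (i, false, 0), true)) (C (some (i, false, 3), true)) (C (some (i, false, 1), true))
      (hne (some (i, false, 0), false)) (hne (some (i, false, 1), false))
      (hne (some (i, false, 2), false)) (hne (some (i, false, 3), false))
      (hne (some (i, false, 2), true)) (hne (some (i, false, 0), true))
      (hne (some (i, false, 3), true)) (hne (some (i, false, 1), true))
      (hpair (some (i, false, 0))) (hpair (some (i, false, 1)))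
      (hpair (some (i, false, 2))) (hpair (some (i, false, 3)))
  have all : ∀ k : ℕ, C (none, false) = C (some ((k : ZMod n), false, 1), true) := by
    intro k
    induction k with
    | zero =>
      have := step 0
      simpa [pv] using this
    | succ k ih =>
      have := step ((k + 1 : ℕ) : ZMod n)
      by_cases h : ((k + 1 : ℕ) : ZMod n) = 0
      · rw [h] at this ⊢
        simpa [pv] using this
      · simp only [pv, if_neg h] at this
        rw [← this, ih]
        simp
  have h1 := all ((-1 : ZMod n).val)
  rw [ZMod.natCast_zmod_val] at h1
  exact hne (none, false) h1.symm

/-- flow values on the 2-factor -/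
noncomputable def xv (n : ℕ) : Lab n × Bool → ℝ
  | (some (_, false, 0), false) => 2
  | (some (_, false, 1), false) => 3 + 1 / n
  | (some (_, false, 2), false) => 2 + 1 / n
  | (some (_, false, 3), false) => 1 + 1 / n
  | (some (_, true, 0), false) => 2 + 1 / n
  | (some (_, true, 1), false) => 3 + 1 / n
  | (some (_, true, 2), false) => 2 + 1 / n
  | (some (_, true, 3), false) => 1
  | (some (i, false, 2), true) => 3 - i.val / n
  | (some (i, false, 0), true) => 2 - i.val / n
  | (some (i, false, 3), true) => 3 - i.val / n
  | (some (i, false, 1), true) => 2 - i.val / n - 1 / n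
  | (some (i, true, 2), true) => 2 + i.val / n
  | (some (i, true, 0), true) => 1 + i.val / n
  | (some (i, true, 3), true) => 2 + i.val / n + 1 / n
  | (some (i, true, 1), true) => 1 + i.val / n + 1 / n
  | (none, false) => 2
  | (none, true) => 1

/-- flow values on the rungs -/
noncomputable def gv (n : ℕ) : Lab n → ℝ
  | some (_, false, 0) => -1
  | some (_, false, 1) => -(1 + 1 / n)
  | some (_, false, 2) => 1
  | some (_, false, 3) => 1
  | some (_, true, 0) => -1
  | some (_, true, 1) => -1
  | some (_, true, 2) => 1
  | some (_, true, 3) => 1 + 1 / n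
  | none => -1

theorem val_sub_one (n : ℕ) [NeZero n] (i : ZMod n) (h : i ≠ 0) :
    ((i - 1).val : ℝ) = i.val - 1 := by
  have h0 : i.val ≠ 0 := fun h' => h ((ZMod.val_eq_zero i).1 h')
  have hlt := ZMod.val_lt i
  have h1 : i - 1 = ((i.val - 1 : ℕ) : ZMod n) := by
    rw [Nat.cast_sub (by omega), ZMod.natCast_zmod_val]
    simp
  rw [h1, ZMod.val_natCast, Nat.mod_eq_of_lt (by omega), Nat.cast_sub (by omega)]
  simp

theorem val_neg_one_real (n : ℕ) [NeZero n] : ((-1 : ZMod n).val : ℝ) = n - 1 := by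
  have hn : 0 < n := Nat.pos_of_ne_zero (NeZero.ne n)
  have h1 : (-1 : ZMod n) = ((n - 1 : ℕ) : ZMod n) := by
    rw [Nat.cast_sub (by omega)]
    simp
  rw [h1, ZMod.val_natCast, Nat.mod_eq_of_lt (by omega), Nat.cast_sub (by omega)]
  simp

theorem ring_flow (n : ℕ) [NeZero n] (T : ℕ) :
    (graph (ring n) T).HasNZFlow (2 + (2 + 1 / (n : ℝ)) / (2 * T + 1)) := by
  have hn : 0 < n := Nat.pos_of_ne_zero (NeZero.ne n)
  have hn' : (1 : ℝ) ≤ n := by exact_mod_cast hn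
  have hn0 : (n : ℝ) ≠ 0 := by positivity
  have hd0 : (0 : ℝ) < 1 / n := by positivity
  have hd1 : 1 / (n : ℝ) ≤ 1 := by rw [div_le_one (by positivity)]; exact hn'
  have hv0 : ∀ i : ZMod n, (0 : ℝ) ≤ i.val / n := fun i => by positivity
  have hv1 : ∀ i : ZMod n, (i.val : ℝ) / n + 1 / n ≤ 1 := by
    intro i
    rw [← add_div, div_le_one (by positivity)]
    have := ZMod.val_lt i
    exact_mod_cast this
  have hneg : ((-1 : ZMod n).val : ℝ) / n = 1 - 1 / n := by
    rw [val_neg_one_real, sub_div, div_self hn0]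
  have hsub : ∀ i : ZMod n, i ≠ 0 → ((i - 1).val : ℝ) / n = i.val / n - 1 / n := by
    intro i h
    rw [val_sub_one n i h, sub_div]
  refine flow_of (ring n) T (xv n) (gv n) (1 / n) hd1 ?_ ?_ ?_ ?_
  · rintro ⟨_ | ⟨i, x, k⟩, b⟩
    · cases b <;> simp only [xv] <;> constructor <;> linarith
    · have h0 := hv0 i
      have h1 := hv1 i
      fin_cases k <;> cases b <;> cases x <;> simp only [xv] <;> constructor <;> linarith
  · rintro (_ | ⟨i, x, k⟩)
    · simp only [gv, abs_neg, abs_one]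
      constructor <;> linarith
    · fin_cases k <;> cases x <;> simp only [gv, abs_neg, abs_one] <;>
        (try rw [abs_of_nonneg (by linarith)]) <;> constructor <;> linarith
  · rintro (_ | ⟨i, x, k⟩)
    · simp only [ring, pv, xv, gv]
      linarith
    · fin_cases k <;> cases x <;> simp only [ring, pv, xv, gv] <;> linarith
  · rintro (_ | ⟨i, x, k⟩)
    · simp only [ring, pv, xv, gv]
      linarith
    · fin_cases k <;> cases x <;> simp only [ring, pv, xv, gv] <;> try linarith
      all_goals
        by_cases h : i = 0
        · subst h
          simp [xv]
          try norm_num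
        · have := hsub i h
          simp only [if_neg h, xv]
          linarith

end FlowRing

/-- For every integer `t ≥ 1` and every real `ε > 0`, there exists
a bridgeless `(2t+1)`-regular class 2 multigraph `G` with
`φ_c(G) < 2 + 2/(2t-1) + ε`. -/
theorem statement_3 (t : ℕ) (ht : 1 ≤ t) (ε : ℝ) (hε : 0 < ε) :
    ∃ G : Multigraph, G.Bridgeless ∧ G.IsRegular (2 * t + 1) ∧ G.IsClass2 ∧
      G.flowNumber < ((2 + 2 / (2 * (t : ℝ) - 1) + ε : ℝ) : EReal) := by
  obtain ⟨T, rfl⟩ : ∃ T, t = T + 1 := ⟨t - 1, by omega⟩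
  obtain ⟨m, hm⟩ := exists_nat_one_div_lt hε
  have hT : (0 : ℝ) ≤ T := Nat.cast_nonneg T
  have hfl := FlowRing.ring_flow (m + 1) T
  refine ⟨FlowRing.graph (FlowRing.ring (m + 1)) T, FlowRing.bridgeless_of_flow _ hfl,
    FlowRing.regular _ _, FlowRing.ring_class2 _ _, ?_⟩
  refine lt_of_le_of_lt (sInf_le ⟨_, rfl, ?_, hfl⟩) ?_
  · have : (0 : ℝ) ≤ (2 + 1 / ((m + 1 : ℕ) : ℝ)) / (2 * T + 1) := by positivity
    linarith
  · rw [EReal.coe_lt_coe_iff]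
    have h1 : (2 * ((T + 1 : ℕ) : ℝ) - 1) = 2 * T + 1 := by push_cast; ring
    rw [h1, add_div]
    have h2 : 1 / ((m + 1 : ℕ) : ℝ) / (2 * T + 1) ≤ 1 / ((m : ℝ) + 1) := by
      push_cast
      apply div_le_self (by positivity)
      linarith
    linarith
end

section
/- For every integer t ≥ 2 and every real ε > 0, there exists a (2t+1)-regular class 1 multigraph G having no perfect matching M such that G − M is bipartite, with φ_c(G) < 2 + 2/(2t−1) + ε. -/
namespace Multigraph
namespace Constr

/-! ### Graphs given by a family of fixed point free involutions -/

section General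

variable {V C : Type} [Finite V] [Finite C]

/-- The multigraph whose colour classes are the given involutions. -/
def colGraph (P : C → V → V) (hne : ∀ c v, P c v ≠ v) : Multigraph where
  V := V
  E := {p : V × C // WellOrderingRel p.1 (P p.2 p.1)}
  vFinite := inferInstance
  eFinite := inferInstance
  ends := fun e => (e.1.1, P e.1.2 e.1.1)
  no_loop := fun e => (hne e.1.2 e.1.1).symm

variable {P : C → V → V}

theorem exists_edge (hinv : ∀ c v, P c (P c v) = v)
    (hne : ∀ c v, P c v ≠ v) (v : V) (c : C) :
    ∃ e : (colGraph P hne).E, e.1.2 = c ∧ (colGraph P hne).Inc v e := by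
  rcases trichotomous_of (WellOrderingRel) v (P c v) with h | h | h
  · exact ⟨⟨(v, c), h⟩, rfl, Or.inl rfl⟩
  · exact absurd h.symm (hne c v)
  · refine ⟨⟨(P c v, c), ?_⟩, rfl, Or.inr (hinv c v)⟩
    simpa [hinv] using h

theorem edge_unique (hinv : ∀ c v, P c (P c v) = v)
    (hne : ∀ c v, P c v ≠ v) (v : V) (e e' : (colGraph P hne).E) (hc : e.1.2 = e'.1.2)
    (h : (colGraph P hne).Inc v e) (h' : (colGraph P hne).Inc v e') : e = e' := by
  obtain ⟨⟨u, c⟩, hu⟩ := e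
  obtain ⟨⟨u', c'⟩, hu'⟩ := e'
  simp only at hc
  subst hc
  simp only [Inc, tail, head, colGraph] at h h' hu hu'
  have key : u = u' := by
    rcases h with h | h <;> rcases h' with h' | h'
    · exact h.trans h'.symm
    · exfalso
      subst h
      rw [← h', hinv] at hu
      exact asymm hu hu'
    · exfalso
      subst h'
      rw [← h, hinv] at hu'
      exact asymm hu hu'
    · rw [← hinv c u, ← hinv c u', h, h']
  subst key
  rfl

theorem inc_partner (hinv : ∀ c v, P c (P c v) = v)
    (hne : ∀ c v, P c v ≠ v) (v : V) (e : (colGraph P hne).E)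
    (h : (colGraph P hne).Inc v e) : (colGraph P hne).Inc (P e.1.2 v) e := by
  rcases h with h | h
  · right; rw [← h]; rfl
  · left; rw [← h]; exact (hinv _ _).symm

theorem degree_eq (hinv : ∀ c v, P c (P c v) = v)
    (hne : ∀ c v, P c v ≠ v) (v : V) : (colGraph P hne).degree v = Nat.card C := by
  refine Nat.card_congr (Equiv.ofBijective (fun e => e.1.1.2) ⟨?_, ?_⟩)
  · rintro ⟨e, he⟩ ⟨e', he'⟩ h
    exact Subtype.ext (edge_unique hinv hne v e e' h he he')
  · intro c
    obtain ⟨e, he, hi⟩ := exists_edge hinv hne v c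
    exact ⟨⟨e, hi⟩, he⟩

theorem class1 [Nonempty V] (hinv : ∀ c v, P c (P c v) = v)
    (hne : ∀ c v, P c v ≠ v) : (colGraph P hne).IsClass1 := by
  have hmax : (colGraph P hne).maxDegree = Nat.card C := by
    have : Set.range (colGraph P hne).degree = {Nat.card C} := by
      ext x
      constructor
      · rintro ⟨v, rfl⟩
        exact degree_eq hinv hne v
      · rintro rfl
        exact ⟨Classical.arbitrary V, degree_eq hinv hne _⟩
    rw [maxDegree, this, csSup_singleton]
  unfold IsClass1
  rw [hmax]
  unfold chromaticIndex
  apply le_antisymm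
  · apply Nat.sInf_le
    refine ⟨fun e => Finite.equivFin C e.1.2, ?_⟩
    rintro e e' ⟨hn, v, h, h'⟩ hc
    exact hn (edge_unique hinv hne v e e' ((Finite.equivFin C).injective hc) h h')
  · apply le_csInf
    · refine ⟨Nat.card C, fun e => Finite.equivFin C e.1.2, ?_⟩
      rintro e e' ⟨hn, v, h, h'⟩ hc
      exact hn (edge_unique hinv hne v e e' ((Finite.equivFin C).injective hc) h h')
    · rintro k ⟨c, hc⟩
      let v : V := Classical.arbitrary V
      rw [← degree_eq hinv hne v]
      have : Function.Injective
          (fun e : {e : (colGraph P hne).E // (colGraph P hne).Inc v e} => c e.1) := by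
        rintro ⟨e, he⟩ ⟨e', he'⟩ h
        by_contra hn
        exact hc e e' ⟨fun h => hn (Subtype.ext h), v, he, he'⟩ h
      simpa [degree] using Nat.card_le_card_of_injective _ this

theorem matching_data (hinv : ∀ c v, P c (P c v) = v)
    (hne : ∀ c v, P c v ≠ v) (M : Set (colGraph P hne).E) (hM : (colGraph P hne).IsPerfectMatching M)
    (hb : ((colGraph P hne).deleteEdges M).IsBipartite) :
    ∃ (m : V → C) (S : Set V), (∀ v, m (P (m v) v) = m v) ∧
      ∀ v c, c ≠ m v → ¬ (v ∈ S ↔ P c v ∈ S) := by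
  choose ed hed huniq using hM
  obtain ⟨S, hS⟩ := hb
  refine ⟨fun v => (ed v).1.2, S, ?_, ?_⟩
  · intro v
    have h1 := inc_partner hinv hne v (ed v) (hed v).2
    have h2 := huniq (P (ed v).1.2 v) (ed v) ⟨(hed v).1, h1⟩
    exact (congrArg (fun e : (colGraph P hne).E => e.1.2) h2).symm
  · intro v c hc
    obtain ⟨e, he, hi⟩ := exists_edge hinv hne v c
    have hnM : e ∉ M := by
      intro hm
      have := huniq v e ⟨hm, hi⟩
      exact hc (by rw [← he, this])
    have h := hS ⟨e, hnM⟩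
    have ht : ((colGraph P hne).deleteEdges M).tail ⟨e, hnM⟩ = e.1.1 := rfl
    have hh : ((colGraph P hne).deleteEdges M).head ⟨e, hnM⟩ = P e.1.2 e.1.1 := rfl
    rw [ht, hh] at h
    rcases hi with hi | hi
    · have : e.1.1 = v := hi
      rw [he, this] at h
      exact h
    · have h3 : P e.1.2 e.1.1 = v := hi
      have h4 : e.1.1 = P c v := by rw [← h3, he, hinv]
      rw [h3, h4] at h
      exact fun h5 => h h5.symm

theorem flow_exists [Fintype C] (hinv : ∀ c v, P c (P c v) = v)
    (hne : ∀ c v, P c v ≠ v) (r : ℝ) (F : V → C → ℝ)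
    (hF : ∀ v c, 1 ≤ |F v c| ∧ |F v c| ≤ r - 1)
    (hanti : ∀ v c, F (P c v) c = - F v c) (hsum : ∀ v, ∑ c, F v c = 0) :
    (colGraph P hne).HasNZFlow r := by
  classical
  refine ⟨fun e => F e.1.1 e.1.2, fun e => hF _ _, ?_⟩
  intro (v : V)
  have h1 : ∑ᶠ e ∈ {e | (colGraph P hne).tail e = v}, F e.1.1 e.1.2
      = ∑ᶠ c ∈ {c | WellOrderingRel v (P c v)}, F v c := by
    refine finsum_mem_eq_of_bijOn (fun e => e.1.2) ⟨?_, ?_, ?_⟩ ?_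
    · rintro e he
      have : e.1.1 = v := he
      have h := e.2
      rw [this] at h
      exact h
    · intro e he e' he' h
      exact edge_unique hinv hne v e e' h (Or.inl he) (Or.inl he')
    · intro c hc
      exact ⟨⟨(v, c), hc⟩, rfl, rfl⟩
    · intro e he
      have : e.1.1 = v := he
      rw [this]
  have h2 : ∑ᶠ e ∈ {e | (colGraph P hne).head e = v}, F e.1.1 e.1.2
      = ∑ᶠ c ∈ {c | ¬ WellOrderingRel v (P c v)}, - F v c := by
    refine finsum_mem_eq_of_bijOn (fun e => e.1.2) ⟨?_, ?_, ?_⟩ ?_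
    · rintro e he
      have : P e.1.2 e.1.1 = v := he
      have h : WellOrderingRel (α := V) e.1.1 (P e.1.2 e.1.1) := e.2
      rw [this] at h
      have h4 : e.1.1 = P e.1.2 v := by rw [← this, hinv]
      rw [h4] at h
      exact fun h' => asymm h h'
    · intro e he e' he' h
      exact edge_unique hinv hne v e e' h (Or.inr he) (Or.inr he')
    · intro c hc
      have hc' : WellOrderingRel (P c v) v := by
        rcases trichotomous_of (WellOrderingRel) v (P c v) with h | h | h
        · exact absurd h hc
        · exact absurd h.symm (hne c v)
        · exact h
      exact ⟨⟨(P c v, c), show WellOrderingRel (P c v) (P c (P c v)) by rw [hinv]; exact hc'⟩, hinv c v, rfl⟩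
    · intro e he
      have : P e.1.2 e.1.1 = v := he
      rw [← this, hanti, neg_neg]
  rw [h1, h2, finsum_mem_eq_finite_toFinset_sum _ (Set.toFinite _),
    finsum_mem_eq_finite_toFinset_sum _ (Set.toFinite _)]
  have h3 := hsum v
  rw [← Finset.sum_filter_add_sum_filter_not _ (fun c => WellOrderingRel v (P c v))] at h3
  rw [Finset.sum_neg_distrib, eq_neg_iff_add_eq_zero]
  convert h3 using 3 <;> ext <;> simp

end General

/-! ### Doubling: fixed points of the involutions become edges between two copies -/

section Double

variable {V C : Type} [DecidableEq V]

/-- Doubled involution. -/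
def dbl (P : C → V → V) (c : C) (v : V × Bool) : V × Bool :=
  if P c v.1 = v.1 then (v.1, !v.2) else (P c v.1, v.2)

theorem dbl_inv {P : C → V → V} (hinv : ∀ c v, P c (P c v) = v) (c : C) (v : V × Bool) :
    dbl P c (dbl P c v) = v := by
  obtain ⟨v, s⟩ := v
  by_cases h : P c v = v
  · simp [dbl, h]
  · simp [dbl, h, hinv, Ne.symm h]

theorem dbl_ne {P : C → V → V} (c : C) (v : V × Bool) : dbl P c v ≠ v := by
  obtain ⟨v, s⟩ := v
  by_cases h : P c v = v
  · simp [dbl, h]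
  · simp [dbl, h]

end Double

/-! ### The concrete graph -/

/-- Colours: `2 s + 3` of them. -/
abbrev Col (s : ℕ) := Option (Option (Option (Fin s ⊕ Fin s)))

/-- Vertices of one half. -/
inductive XV (N : ℕ) : Type
  | a (i : Fin N) | aa (i : Fin N) | d (i : Fin N) | b (i : Fin N) | w (i : Fin N)
  | ta | tb | td

noncomputable instance (N : ℕ) : DecidableEq (XV N) := Classical.decEq _

/-- Index code used for finiteness. -/
def XV.code {N : ℕ} : XV N → Fin 8 × Option (Fin N)
  | .a i => (0, some i) | .aa i => (1, some i) | .d i => (2, some i)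
  | .b i => (3, some i) | .w i => (4, some i)
  | .ta => (5, none) | .tb => (6, none) | .td => (7, none)

instance (N : ℕ) : Finite (XV N) :=
  Finite.of_injective XV.code (by
    intro u v h
    cases u <;> cases v <;> simp_all [XV.code])

/-- The colour involutions (with fixed points) on one half. -/
def P (s n : ℕ) : Col s → XV (n + 1) → XV (n + 1)
  | none, .a i => .aa i
  | some none, .a i => .d i
  | some (some none), .a i => .b i
  | some (some (some (.inl _))), .a i => .d i
  | some (some (some (.inr _))), .a i => .b i
  | none, .aa i => .a i
  | some none, .aa i => if i.1 = 0 then .b i else .aa i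
  | some (some none), .aa i => .d i
  | some (some (some (.inl _))), .aa i => .aa i
  | some (some (some (.inr _))), .aa i => .d i
  | none, .d i => .d i
  | some none, .d i => .a i
  | some (some none), .d i => .aa i
  | some (some (some (.inl _))), .d i => .a i
  | some (some (some (.inr _))), .d i => .aa i
  | none, .b i => .w i
  | some none, .b i => if i.1 = 0 then .aa i else .w ⟨i.1 - 1, by omega⟩
  | some (some none), .b i => .a i
  | some (some (some (.inl _))), .b i => .w i
  | some (some (some (.inr _))), .b i => .a i
  | none, .w i => .b i
  | some none, .w i => if h : i.1 + 1 < n + 1 then .b ⟨i.1 + 1, h⟩ else .td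
  | some (some none), .w i => .w i
  | some (some (some (.inl _))), .w i => .b i
  | some (some (some (.inr _))), .w i => .w i
  | none, .ta => .td
  | some none, .ta => .tb
  | some (some none), .ta => .ta
  | some (some (some (.inl _))), .ta => .td
  | some (some (some (.inr _))), .ta => .ta
  | none, .tb => .tb
  | some none, .tb => .ta
  | some (some none), .tb => .td
  | some (some (some (.inl _))), .tb => .tb
  | some (some (some (.inr _))), .tb => .td
  | none, .td => .ta
  | some none, .td => .w ⟨n, by omega⟩
  | some (some none), .td => .tb
  | some (some (some (.inl _))), .td => .ta
  | some (some (some (.inr _))), .td => .tb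

theorem P_inv (s n : ℕ) (c : Col s) (v : XV (n + 1)) : P s n c (P s n c v) = v := by
  rcases c with _ | _ | _ | j | j <;> rcases v with i | i | i | i | i | _ | _ | _ <;>
    try rfl
  · by_cases h : i.1 = 0 <;> simp [P, h]
  · by_cases h : i.1 = 0
    · simp [P, h]
    · have h1 : i.1 - 1 + 1 = i.1 := by omega
      have h2 : i.1 - 1 < n := by omega
      simp [P, h, h1]
      omega
  · by_cases h : i.1 < n
    · simp [P, h]
    · simp only [P, Nat.add_lt_add_iff_right, h, dite_false]
      congr 1
      ext
      simp
      omega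
  · simp [P]

/-- Sign: whites `1`, blacks `-1`. -/
def sg {N : ℕ} : XV N → ℝ
  | .a _ => 1 | .aa _ => 1 | .d _ => -1 | .b _ => -1 | .w _ => 1
  | .ta => 1 | .tb => 1 | .td => -1

/-- Direction on the first colour. -/
def dy {N : ℕ} : XV N → ℝ
  | .a _ => 1 | .aa _ => -1 | .d _ => -1 | .b _ => 1 | .w _ => -1
  | .ta => -1 | .tb => 1 | .td => 1

/-- Deviation on the first colour. -/
noncomputable def xy {N : ℕ} (δ : ℝ) : XV N → ℝ
  | .a _ => 1 - δ | .aa _ => 1 + δ | .d _ => 1 + δ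
  | .b i => 1 - (2 * (i.1 : ℝ) + 1) * δ | .w i => 1 - (2 * (i.1 : ℝ) + 1) * δ
  | .ta => 2 * δ | .tb => 0 | .td => 2 * δ

/-- Deviation on the second colour. -/
noncomputable def xq {N : ℕ} (δ : ℝ) : XV N → ℝ
  | .a _ => 0 | .aa _ => 0 | .d _ => 0
  | .b i => 2 * (i.1 : ℝ) * δ | .w i => 2 * ((i.1 : ℝ) + 1) * δ
  | .ta => 1 - δ | .tb => 1 + δ | .td => 2 * (N : ℝ) * δ

/-- Deviation on the third colour. -/
noncomputable def xz {N : ℕ} (δ : ℝ) : XV N → ℝ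
  | .a _ => 2 * δ | .b _ => 2 * δ
  | _ => 0

/-- The half-edge flow on one half. -/
noncomputable def fl {N s : ℕ} (δ r : ℝ) (v : XV N) : Col s → ℝ
  | none => dy v * (r / 2) + (r / 2 - 1) * (sg v * (1 - xy δ v))
  | some none => - dy v * (r / 2) + (r / 2 - 1) * (sg v * (1 - xq δ v))
  | some (some none) => - sg v * (r / 2) + (r / 2 - 1) * (sg v * (1 - xz δ v))
  | some (some (some (.inl _))) => sg v * (r / 2) + (r / 2 - 1) * sg v
  | some (some (some (.inr _))) => - sg v * (r / 2) + (r / 2 - 1) * sg v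

theorem fl_anti {s n : ℕ} (δ r : ℝ) (v : XV (n + 1)) (c : Col s) (h : P s n c v ≠ v) :
    fl δ r (P s n c v) c = - fl δ r v c := by
  rcases c with _ | _ | _ | j | j <;> rcases v with i | i | i | i | i | _ | _ | _ <;>
    first
    | exact absurd rfl h
    | (simp only [P, fl, sg, dy, xy, xq, xz]; push_cast; ring1)
    | (simp only [P, fl, sg, dy, xy, xq, xz]; ring1)
    | skip
  · by_cases h0 : i.1 = 0
    · simp only [P, h0, if_true, fl, sg, dy, xq]; push_cast; ring
    · exact absurd (by simp [P, h0]) h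
  · by_cases h0 : i.1 = 0
    · simp only [P, h0, if_true, fl, sg, dy, xq]; push_cast; ring
    · have h1 : ((i.1 - 1 : ℕ) : ℝ) = (i.1 : ℝ) - 1 := by
        rw [Nat.cast_sub (by omega)]; simp
      simp only [P, h0, if_false, fl, sg, dy, xq, h1]; ring
  · by_cases h0 : i.1 + 1 < n + 1
    · simp only [P, h0, dite_true, fl, sg, dy, xq]; push_cast; ring
    · have h1 : i.1 = n := by omega
      have h2 : P s n (some none) (.w i) = .td := by simp [P, h1]
      rw [h2]
      simp only [fl, sg, dy, xq, h1]; push_cast; ring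

theorem fl_sum {s n : ℕ} (δ r : ℝ) (hδ : δ * (2 * ((n : ℝ) + 1) + 1) = 1)
    (hr : (r / 2 - 1) * (2 * (s : ℝ) + 2 - δ) = r / 2) (v : XV (n + 1)) :
    ∑ c : Col s, fl δ r v c = 0 := by
  simp only [Fintype.sum_option, Fintype.sum_sum_type, fl, Finset.sum_const, Finset.card_univ,
    Fintype.card_fin, nsmul_eq_mul]
  rcases v with i | i | i | i | i | _ | _ | _ <;> simp only [sg, dy, xy, xq, xz] <;>
    push_cast
  · linear_combination hr
  · linear_combination hr
  · linear_combination -hr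
  · linear_combination -hr
  · linear_combination hr
  · linear_combination hr
  · linear_combination hr
  · linear_combination -hr + (r / 2 - 1) * hδ

theorem bound_aux {r D h : ℝ} (hr : 2 ≤ r) (hD : D = 1 ∨ D = -1) (hh : |h| ≤ 1) :
    1 ≤ |D * (r / 2) + (r / 2 - 1) * h| ∧ |D * (r / 2) + (r / 2 - 1) * h| ≤ r - 1 := by
  rw [abs_le] at hh
  have h1 : (r / 2 - 1) * h ≤ r / 2 - 1 := by nlinarith
  have h2 : -(r / 2 - 1) ≤ (r / 2 - 1) * h := by nlinarith
  rcases hD with rfl | rfl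
  · rw [abs_of_nonneg (by linarith)]
    constructor <;> linarith
  · rw [abs_of_nonpos (by linarith)]
    constructor <;> linarith

theorem sg_cases {N : ℕ} (v : XV N) : sg v = 1 ∨ sg v = -1 := by
  cases v <;> simp [sg]

theorem dy_cases {N : ℕ} (v : XV N) : dy v = 1 ∨ dy v = -1 := by
  cases v <;> simp [dy]

theorem neg_cases {x : ℝ} (h : x = 1 ∨ x = -1) : -x = 1 ∨ -x = -1 := by
  rcases h with rfl | rfl <;> simp

theorem sg_abs {N : ℕ} (v : XV N) (x : ℝ) (h0 : 0 ≤ x) (h2 : x ≤ 2) : |sg v * (1 - x)| ≤ 1 := by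
  rw [abs_le]
  rcases sg_cases v with h | h <;> rw [h] <;> constructor <;> linarith

theorem fl_bound {s n : ℕ} (δ r : ℝ) (hδ0 : 0 < δ) (hδ : δ * (2 * ((n : ℝ) + 1) + 1) = 1)
    (hr : 2 ≤ r) (v : XV (n + 1)) (c : Col s) :
    1 ≤ |fl δ r v c| ∧ |fl δ r v c| ≤ r - 1 := by
  have hn : (0 : ℝ) ≤ n := Nat.cast_nonneg n
  have hδ1 : δ ≤ 1 / 3 := by nlinarith
  have hi0 : ∀ i : Fin (n + 1), (0 : ℝ) ≤ (i.1 : ℝ) * δ := fun i => by positivity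
  have hi1 : ∀ i : Fin (n + 1), (i.1 : ℝ) * δ ≤ n * δ := fun i => by
    have : (i.1 : ℝ) ≤ n := by exact_mod_cast Nat.lt_succ_iff.mp i.2
    exact mul_le_mul_of_nonneg_right this hδ0.le
  rcases c with _ | _ | _ | j | j <;> simp only [fl]
  · refine bound_aux hr (dy_cases v) (sg_abs v _ ?_ ?_) <;>
    rcases v with i | i | i | i | i | _ | _ | _ <;> simp only [xy] <;>
    first
    | linarith
    | linarith [hi0 i, hi1 i]
  · refine bound_aux hr (neg_cases (dy_cases v)) (sg_abs v _ ?_ ?_) <;>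
    rcases v with i | i | i | i | i | _ | _ | _ <;> simp only [xq] <;> push_cast <;>
    first
    | linarith
    | linarith [hi0 i, hi1 i]
  · refine bound_aux hr (neg_cases (sg_cases v)) (sg_abs v _ ?_ ?_) <;>
    rcases v with i | i | i | i | i | _ | _ | _ <;> simp only [xz] <;> linarith
  · refine bound_aux hr (sg_cases v) ?_
    rcases sg_cases v with h | h <;> rw [h] <;> simp
  · refine bound_aux hr (neg_cases (sg_cases v)) ?_
    rcases sg_cases v with h | h <;> rw [h] <;> simp

/-! ### No suitable perfect matching -/

/-- In a triangle with one simple edge (colour `y`) and two multiple edges,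
the simple edge is in the matching. -/
theorem forced {V C : Type} {Q : C → V → V} {m : V → C} {S : Set V}
    (hS : ∀ v c, c ≠ m v → ¬ (v ∈ S ↔ Q c v ∈ S))
    {u u' d : V} {y c₁ c₂ c₃ c₄ : C} (h12 : c₁ ≠ c₂) (h34 : c₃ ≠ c₄)
    (hy : Q y u = u') (h1 : Q c₁ d = u) (h2 : Q c₂ d = u)
    (h3 : Q c₃ d = u') (h4 : Q c₄ d = u') : m u = y := by
  by_contra hne
  have e1 := hS u y (fun h => hne h.symm)
  rw [hy] at e1
  have e2 : ¬ (d ∈ S ↔ u ∈ S) := by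
    by_cases h : c₁ = m d
    · have := hS d c₂ (fun h' => h12 (h.trans h'.symm))
      rwa [h2] at this
    · have := hS d c₁ h
      rwa [h1] at this
  have e3 : ¬ (d ∈ S ↔ u' ∈ S) := by
    by_cases h : c₃ = m d
    · have := hS d c₄ (fun h' => h34 (h.trans h'.symm))
      rwa [h4] at this
    · have := hS d c₃ h
      rwa [h3] at this
  tauto

theorem no_matching (s n : ℕ) (hs : 1 ≤ s) (m : XV (n + 1) × Bool → Col s)
    (S : Set (XV (n + 1) × Bool)) (hm : ∀ v, m (dbl (P s n) (m v) v) = m v)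
    (hS : ∀ v c, c ≠ m v → ¬ (v ∈ S ↔ dbl (P s n) c v ∈ S)) : False := by
  let j : Fin s := ⟨0, hs⟩
  have hma : ∀ i, m (.a i, false) = none := fun i =>
    forced hS (u := (.a i, false)) (u' := (.aa i, false)) (d := (.d i, false))
      (c₁ := some none) (c₂ := some (some (some (.inl j))))
      (c₃ := some (some none)) (c₄ := some (some (some (.inr j))))
      (by simp) (by simp) (by simp [dbl, P]) (by simp [dbl, P]) (by simp [dbl, P])
      (by simp [dbl, P]) (by simp [dbl, P])
  have hmaa : ∀ i, m (.aa i, false) = none := fun i => by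
    have := hm (.a i, false)
    rw [hma i] at this
    simpa [dbl, P] using this
  have hta : m (.ta, false) = some none :=
    forced hS (u := (.ta, false)) (u' := (.tb, false)) (d := (.td, false))
      (c₁ := none) (c₂ := some (some (some (.inl j))))
      (c₃ := some (some none)) (c₄ := some (some (some (.inr j))))
      (by simp) (by simp) (by simp [dbl, P]) (by simp [dbl, P]) (by simp [dbl, P])
      (by simp [dbl, P]) (by simp [dbl, P])
  have htb : m (.tb, false) = some none := by
    have := hm (.ta, false)
    rw [hta] at this
    simpa [dbl, P] using this
  have htd : m (.td, false) = some none := by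
    have := hm (.td, false)
    rcases hc : m (.td, false) with _ | _ | _ | k | k <;> rw [hc] at this <;>
      simp [dbl, P, hta, htb] at this ⊢
  have hlast : m (.w ⟨n, by omega⟩, false) = some none := by
    have := hm (.td, false)
    rw [htd] at this
    simpa [dbl, P] using this
  have hbw : ∀ i, m (.b i, false) ≠ some none → m (.w i, false) ≠ some none := by
    intro i hi
    have := hm (.b i, false)
    rcases hc : m (.b i, false) with _ | _ | _ | k | k <;> rw [hc] at this <;>
      simp [dbl, P, hma] at this
    · rw [this]; simp
    · exact absurd hc hi
    · rw [this]; simp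
  have hb : ∀ k (hk : k < n + 1), m (.b ⟨k, hk⟩, false) ≠ some none := by
    intro k
    induction k with
    | zero =>
      intro hk hc
      have := hm (.b ⟨0, hk⟩, false)
      rw [hc] at this
      simp only [dbl, P] at this
      simp [hmaa] at this
    | succ k ih =>
      intro hk hc
      have := hm (.b ⟨k + 1, hk⟩, false)
      rw [hc] at this
      simp [dbl, P] at this
      exact hbw _ (ih (by omega)) this
  exact hbw _ (hb n (by omega)) hlast

end Constr
end Multigraph

open Multigraph Multigraph.Constr in
/-- For every integer `t ≥ 2` and every real `ε > 0`, there exists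
a `(2t+1)`-regular class 1 multigraph `G` having no perfect matching `M` with
`G - M` bipartite, such that `φ_c(G) < 2 + 2/(2t-1) + ε`. -/
theorem statement_4 (t : ℕ) (ht : 2 ≤ t) (ε : ℝ) (hε : 0 < ε) :
    ∃ G : Multigraph, G.IsRegular (2 * t + 1) ∧ G.IsClass1 ∧
      (¬ ∃ M : Set G.E, G.IsPerfectMatching M ∧ (G.deleteEdges M).IsBipartite) ∧
      G.flowNumber < ((2 + 2 / (2 * (t : ℝ) - 1) + ε : ℝ) : EReal) := by
  obtain ⟨s, rfl⟩ : ∃ s, t = s + 1 := ⟨t - 1, by omega⟩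
  have hs : 1 ≤ s := by omega
  obtain ⟨n, hn⟩ := exists_nat_gt (1 / ε)
  have hinv := dbl_inv (P_inv s n)
  have hne : ∀ c v, dbl (P s n) c v ≠ v := fun c v => dbl_ne c v
  have : Nonempty (XV (n + 1) × Bool) := ⟨(.ta, false)⟩
  refine ⟨colGraph (dbl (P s n)) hne, ?_, class1 hinv hne, ?_, ?_⟩
  · intro v
    rw [degree_eq hinv hne v]
    simp
    ring
  · rintro ⟨M, hM, hb⟩
    obtain ⟨m, S, hm, hS⟩ := matching_data hinv hne M hM hb
    exact no_matching s n hs m S hm hS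
  · have hn0 : (0 : ℝ) ≤ n := Nat.cast_nonneg n
    have hs1 : (1 : ℝ) ≤ s := by exact_mod_cast hs
    set δ : ℝ := 1 / (2 * ((n : ℝ) + 1) + 1) with hδdef
    have hδ0 : 0 < δ := by positivity
    have hδ : δ * (2 * ((n : ℝ) + 1) + 1) = 1 := by
      rw [hδdef]; field_simp
    have hδ1 : δ ≤ 1 / 3 := by nlinarith
    have hδε : 2 * δ < ε := by
      rw [div_lt_iff₀ hε] at hn
      by_contra hcon
      push Not at hcon
      nlinarith
    have hpos : 0 < 2 * (s : ℝ) + 1 - δ := by linarith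
    set r : ℝ := 2 + 2 / (2 * (s : ℝ) + 1 - δ) with hrdef
    have hr2 : 2 ≤ r := by
      have : 0 < 2 / (2 * (s : ℝ) + 1 - δ) := by positivity
      linarith
    have hr : (r / 2 - 1) * (2 * (s : ℝ) + 2 - δ) = r / 2 := by
      rw [hrdef]; field_simp; ring
    have hflow : (colGraph (dbl (P s n)) hne).HasNZFlow r := by
      refine flow_exists hinv hne r
        (fun v c => (if v.2 then -1 else 1) * fl δ r v.1 c) ?_ ?_ ?_
      · rintro ⟨v, x⟩ c
        have := fl_bound δ r hδ0 hδ hr2 v c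
        cases x <;> simpa using this
      · rintro ⟨v, x⟩ c
        by_cases h : P s n c v = v
        · cases x <;> simp [dbl, h]
        · cases x <;> simp [dbl, h, fl_anti δ r v c h]
      · rintro ⟨v, x⟩
        rw [← Finset.mul_sum, fl_sum δ r hδ hr v, mul_zero]
    refine lt_of_le_of_lt (sInf_le ⟨r, rfl, hr2, hflow⟩) ?_
    rw [EReal.coe_lt_coe_iff, hrdef]
    push_cast
    have h3 : 2 / (2 * (s : ℝ) + 1 - δ) - 2 / (2 * ((s : ℝ) + 1) - 1) ≤ 2 * δ := by
      have hp2 : 0 < 2 * ((s : ℝ) + 1) - 1 := by linarith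
      rw [div_sub_div _ _ hpos.ne' hp2.ne', div_le_iff₀ (by positivity)]
      have : 1 ≤ (2 * (s : ℝ) + 1 - δ) * (2 * ((s : ℝ) + 1) - 1) := by nlinarith
      nlinarith
    linarith
end
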